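/- Under the stated hypotheses, there exist positive constants δ₀, ε₀ and C, depending only on p, μ, κ, s, c₁, C₁, v₋, v₊ and independent of α, β and T, such that if δ ≤ δ₀ and ε ≤ ε₀ then for all t ∈ [0, T]: (i) for every η > 0 there exists C_η > 0 (independent of α, β, T) with |∫₀^t (p'(V)φ_xx φ_xxx)(0,τ) dτ| ≤ η ∫₀^t ‖φ_xxxx(τ)‖² dτ + C_η ∫₀^t ‖φ_xx(τ)‖₁² dτ; and (ii) |∫₀^t (ψ_xx ψ_xxx)(0,τ) dτ| ≤ C ∫₀^t ‖ψ_xx(τ)‖₁² dτ + C e^{−c₁β}. -/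

import Mathlib

open MeasureTheory Filter Set Real

/-- Spatial partial derivative `∂f/∂x` of a function `f(x,t)`. -/
noncomputable def pdx (f : ℝ → ℝ → ℝ) : ℝ → ℝ → ℝ := fun x t => deriv (fun y => f y t) x

/-- Temporal partial derivative `∂f/∂t` of a function `f(x,t)`. -/
noncomputable def pdt (f : ℝ → ℝ → ℝ) : ℝ → ℝ → ℝ := fun x t => deriv (fun r => f x r) t

/-- `‖f(·,t)‖²`, the squared `L²(0,∞)` norm in `x` at time `t`. -/
noncomputable def sqnorm (f : ℝ → ℝ → ℝ) (t : ℝ) : ℝ := ∫ x in Set.Ioi (0:ℝ), (f x t) ^ 2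

/-- `‖f(·,t)‖ₖ²`, the squared `Hᵏ(0,∞)` Sobolev norm in `x` at time `t`. -/
noncomputable def Hsq (k : ℕ) (f : ℝ → ℝ → ℝ) (t : ℝ) : ℝ :=
  ∑ j ∈ Finset.range (k + 1), sqnorm (pdx^[j] f) t

/-- The nonlinear source term `F` of the reformulated Navier–Stokes–Korteweg system,
where the shock profile `(V, U)` is evaluated at `ξ = x − st + α − β` and
`v = V + φ_x`. -/
noncomputable def NSKF (p : ℝ → ℝ) (μ κ s α β : ℝ) (V U : ℝ → ℝ)
    (φ ψ : ℝ → ℝ → ℝ) (x t : ℝ) : ℝ :=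
  -(p (V (x - s*t + α - β) + pdx φ x t) - p (V (x - s*t + α - β))
      - deriv p (V (x - s*t + α - β)) * pdx φ x t)
  - μ * pdx (pdx ψ) x t * pdx φ x t
      / ((V (x - s*t + α - β) + pdx φ x t) * V (x - s*t + α - β))
  + κ * deriv (deriv V) (x - s*t + α - β)
      * (1 / (V (x - s*t + α - β)) ^ 5 - 1 / (V (x - s*t + α - β) + pdx φ x t) ^ 5)
  + (5 * κ / 2) * ((pdx (pdx φ) x t) ^ 2 + 2 * pdx (pdx φ) x t * deriv V (x - s*t + α - β))
      / (V (x - s*t + α - β) + pdx φ x t) ^ 6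
  + (5 * κ / 2) * (deriv V (x - s*t + α - β)) ^ 2
      * (1 / (V (x - s*t + α - β)) ^ 6 - 1 / (V (x - s*t + α - β) + pdx φ x t) ^ 6)
  + μ * deriv U (x - s*t + α - β) * (pdx φ x t) ^ 2
      / ((V (x - s*t + α - β) + pdx φ x t) * (V (x - s*t + α - β)) ^ 2)

section PartialDerivatives

variable {f g : ℝ → ℝ → ℝ}

lemma hasDerivAt_slice_fst (hf : ContDiff ℝ (⊤ : ℕ∞) (Function.uncurry f)) (x t : ℝ) :
    HasDerivAt (fun y => f y t) (fderiv ℝ (Function.uncurry f) (x, t) (1, 0)) x := by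
  have h1 : HasFDerivAt (Function.uncurry f) (fderiv ℝ (Function.uncurry f) (x, t)) (x, t) :=
    (hf.differentiable (by simp) (x, t)).hasFDerivAt
  have h2 : HasDerivAt (fun y : ℝ => (y, t)) ((1 : ℝ), (0 : ℝ)) x :=
    (hasDerivAt_id x).prodMk (hasDerivAt_const x t)
  exact h1.comp_hasDerivAt x h2

lemma hasDerivAt_slice_snd (hf : ContDiff ℝ (⊤ : ℕ∞) (Function.uncurry f)) (x t : ℝ) :
    HasDerivAt (fun r => f x r) (fderiv ℝ (Function.uncurry f) (x, t) (0, 1)) t := by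
  have h1 : HasFDerivAt (Function.uncurry f) (fderiv ℝ (Function.uncurry f) (x, t)) (x, t) :=
    (hf.differentiable (by simp) (x, t)).hasFDerivAt
  have h2 : HasDerivAt (fun r : ℝ => (x, r)) ((0 : ℝ), (1 : ℝ)) t :=
    (hasDerivAt_const t x).prodMk (hasDerivAt_id t)
  exact h1.comp_hasDerivAt t h2

lemma uncurry_pdx (hf : ContDiff ℝ (⊤ : ℕ∞) (Function.uncurry f)) :
    Function.uncurry (pdx f) = fun z => fderiv ℝ (Function.uncurry f) z (1, 0) := by
  ext ⟨x, t⟩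
  exact (hasDerivAt_slice_fst hf x t).deriv

lemma uncurry_pdt (hf : ContDiff ℝ (⊤ : ℕ∞) (Function.uncurry f)) :
    Function.uncurry (pdt f) = fun z => fderiv ℝ (Function.uncurry f) z (0, 1) := by
  ext ⟨x, t⟩
  exact (hasDerivAt_slice_snd hf x t).deriv

lemma contDiff_pdx (hf : ContDiff ℝ (⊤ : ℕ∞) (Function.uncurry f)) :
    ContDiff ℝ (⊤ : ℕ∞) (Function.uncurry (pdx f)) := by
  rw [uncurry_pdx hf]
  exact (hf.fderiv_right (m := ((⊤ : ℕ∞) : WithTop ℕ∞)) (by simp)).clm_apply contDiff_const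

lemma contDiff_pdt (hf : ContDiff ℝ (⊤ : ℕ∞) (Function.uncurry f)) :
    ContDiff ℝ (⊤ : ℕ∞) (Function.uncurry (pdt f)) := by
  rw [uncurry_pdt hf]
  exact (hf.fderiv_right (m := ((⊤ : ℕ∞) : WithTop ℕ∞)) (by simp)).clm_apply contDiff_const

lemma hasDerivAt_pdx (hf : ContDiff ℝ (⊤ : ℕ∞) (Function.uncurry f)) (x t : ℝ) :
    HasDerivAt (fun y => f y t) (pdx f x t) x :=
  (hasDerivAt_slice_fst hf x t).differentiableAt.hasDerivAt

lemma hasDerivAt_pdt (hf : ContDiff ℝ (⊤ : ℕ∞) (Function.uncurry f)) (x t : ℝ) :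
    HasDerivAt (fun r => f x r) (pdt f x t) t :=
  (hasDerivAt_slice_snd hf x t).differentiableAt.hasDerivAt

lemma pdt_pdx_comm (hf : ContDiff ℝ (⊤ : ℕ∞) (Function.uncurry f)) :
    pdt (pdx f) = pdx (pdt f) := by
  have hd : ∀ z w v : ℝ × ℝ, fderiv ℝ (fun z => fderiv ℝ (Function.uncurry f) z v) z w
      = fderiv ℝ (fderiv ℝ (Function.uncurry f)) z w v := by
    intro z w v
    have h1 : DifferentiableAt ℝ (fderiv ℝ (Function.uncurry f)) z :=
      (hf.fderiv_right (m := ((⊤ : ℕ∞) : WithTop ℕ∞)) (by simp)).differentiable (by simp) z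
    rw [fderiv_clm_apply h1 (differentiableAt_const v)]
    simp
  have h1 := uncurry_pdt (contDiff_pdx hf)
  have h2 := uncurry_pdx (contDiff_pdt hf)
  rw [uncurry_pdx hf] at h1
  rw [uncurry_pdt hf] at h2
  ext x t
  have e1 := congrFun h1 (x, t)
  have e2 := congrFun h2 (x, t)
  simp only [hd, Function.uncurry_apply_pair] at e1 e2
  rw [e1, e2]
  refine ContDiffAt.isSymmSndFDerivAt hf.contDiffAt ?_ _ _
  simp only [minSmoothness_of_isRCLikeNormedField]
  exact WithTop.coe_le_coe.2 (le_top : (2 : ℕ∞) ≤ ⊤)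

/-- Spatial differentiation of a pointwise identity on an open half-line. -/
lemma pdx_congr_of_pos {t : ℝ} (h : ∀ x > (0 : ℝ), f x t = g x t) {x : ℝ} (hx : 0 < x) :
    pdx f x t = pdx g x t := by
  apply Filter.EventuallyEq.deriv_eq
  filter_upwards [lt_mem_nhds hx] with y hy using h y hy

lemma eq_on_closed_strip (hf : Continuous (Function.uncurry f))
    (hg : Continuous (Function.uncurry g)) {T : ℝ} (hT : 0 < T)
    (h : ∀ x ∈ Ioi (0 : ℝ), ∀ t ∈ Ioo (0 : ℝ) T, f x t = g x t) {x t : ℝ}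
    (hx : 0 ≤ x) (ht : t ∈ Icc 0 T) : f x t = g x t := by
  have hc : IsClosed {z : ℝ × ℝ | Function.uncurry f z = Function.uncurry g z} :=
    isClosed_eq hf hg
  have hsub : Ioi (0 : ℝ) ×ˢ Ioo (0 : ℝ) T ⊆
      {z : ℝ × ℝ | Function.uncurry f z = Function.uncurry g z} := fun z hz => h z.1 hz.1 z.2 hz.2
  have := closure_minimal hsub hc
  rw [closure_prod_eq, closure_Ioi, closure_Ioo hT.ne] at this
  exact this (show (x, t) ∈ _ from ⟨hx, ht⟩)

lemma continuous_slice_fst (hf : ContDiff ℝ (⊤ : ℕ∞) (Function.uncurry f)) (t : ℝ) :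
    Continuous fun x => f x t :=
  hf.continuous.comp (by fun_prop : Continuous fun x : ℝ => (x, t))

lemma continuous_slice_snd (hf : ContDiff ℝ (⊤ : ℕ∞) (Function.uncurry f)) (x : ℝ) :
    Continuous fun t => f x t :=
  hf.continuous.comp (by fun_prop : Continuous fun t : ℝ => (x, t))

end PartialDerivatives

section WaveShift

variable {W : ℝ → ℝ} {f : ℝ → ℝ → ℝ} (s α β : ℝ)

lemma contDiff_wave_add (hW : ContDiff ℝ (⊤ : ℕ∞) W)
    (hf : ContDiff ℝ (⊤ : ℕ∞) (Function.uncurry f)) :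
    ContDiff ℝ (⊤ : ℕ∞) (Function.uncurry fun x t => W (x - s * t + α - β) + f x t) := by
  have : ContDiff ℝ (⊤ : ℕ∞) fun z : ℝ × ℝ => W (z.1 - s * z.2 + α - β) :=
    hW.comp (by fun_prop)
  exact this.add hf

lemma pdx_wave_add (hW : ContDiff ℝ (⊤ : ℕ∞) W)
    (hf : ContDiff ℝ (⊤ : ℕ∞) (Function.uncurry f)) :
    pdx (fun x t => W (x - s * t + α - β) + f x t)
      = fun x t => deriv W (x - s * t + α - β) + pdx f x t := by
  ext x t
  have h1 : HasDerivAt W (deriv W (x - s * t + α - β)) (x - s * t + α - β) :=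
    (hW.differentiable (by simp) _).hasDerivAt
  have h2 : HasDerivAt (fun y => y - s * t + α - β) 1 x :=
    (((hasDerivAt_id x).sub_const _).add_const _).sub_const _
  have h3 := (h1.comp x h2).add (hasDerivAt_pdx hf x t)
  rw [mul_one] at h3
  exact h3.deriv

lemma pdt_wave_add (hW : ContDiff ℝ (⊤ : ℕ∞) W)
    (hf : ContDiff ℝ (⊤ : ℕ∞) (Function.uncurry f)) :
    pdt (fun x t => W (x - s * t + α - β) + f x t)
      = fun x t => -s * deriv W (x - s * t + α - β) + pdt f x t := by
  ext x t
  have h1 : HasDerivAt W (deriv W (x - s * t + α - β)) (x - s * t + α - β) :=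
    (hW.differentiable (by simp) _).hasDerivAt
  have h2 : HasDerivAt (fun r => x - s * r + α - β) (-s) t := by
    have := (((hasDerivAt_id t).const_mul s).const_sub x).add_const (α) |>.sub_const β
    simpa using this
  have h3 := (h1.comp t h2).add (hasDerivAt_pdt hf x t)
  rw [mul_comm] at h3
  exact h3.deriv

lemma contDiff_deriv {W : ℝ → ℝ} (hW : ContDiff ℝ (⊤ : ℕ∞) W) :
    ContDiff ℝ (⊤ : ℕ∞) (deriv W) :=
  (contDiff_infty_iff_deriv.1 hW).2

end WaveShift

section Sobolev

/-- The interpolation form of the one-dimensional Sobolev trace inequality. -/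
lemma sq_le_of_integrable_sq {f f' : ℝ → ℝ} (hd : ∀ x, HasDerivAt f (f' x) x)
    (hc' : Continuous f') (hf : IntegrableOn (fun x => f x ^ 2) (Ioi 0))
    (hf' : IntegrableOn (fun x => f' x ^ 2) (Ioi 0)) (hlim : Tendsto f atTop (nhds 0))
    {l : ℝ} (hl : 0 < l) {x : ℝ} (hx : 0 ≤ x) :
    f x ^ 2 ≤ l * (∫ y in Ioi (0 : ℝ), f y ^ 2) + l⁻¹ * ∫ y in Ioi (0 : ℝ), f' y ^ 2 := by
  have hc : Continuous f := continuous_iff_continuousAt.2 fun x => (hd x).continuousAt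
  have hle : ∀ y, |2 * f y * f' y| ≤ l * f y ^ 2 + l⁻¹ * f' y ^ 2 := by
    intro y
    have h1 : l * f y ^ 2 + l⁻¹ * f' y ^ 2 - 2 * f y * f' y = l * (f y - l⁻¹ * f' y) ^ 2 := by
      field_simp; ring
    have h2 : l * f y ^ 2 + l⁻¹ * f' y ^ 2 + 2 * f y * f' y = l * (f y + l⁻¹ * f' y) ^ 2 := by
      field_simp; ring
    have h3 : 0 ≤ l * (f y - l⁻¹ * f' y) ^ 2 := by positivity
    have h4 : 0 ≤ l * (f y + l⁻¹ * f' y) ^ 2 := by positivity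
    rw [abs_le]; constructor <;> linarith
  have hint : IntegrableOn (fun y => l * f y ^ 2 + l⁻¹ * f' y ^ 2) (Ioi 0) :=
    (hf.const_mul l).add (hf'.const_mul l⁻¹)
  have hsub : Ioi x ⊆ Ioi (0 : ℝ) := Ioi_subset_Ioi hx
  have hff' : IntegrableOn (fun y => 2 * f y * f' y) (Ioi x) := by
    refine Integrable.mono' (hint.mono_set hsub) ?_ (Eventually.of_forall hle)
    exact (by fun_prop : Continuous fun y => 2 * f y * f' y).aestronglyMeasurable
  have key := integral_Ioi_of_hasDerivAt_of_tendsto' (a := x) (f := fun y => f y ^ 2)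
    (f' := fun y => 2 * f y * f' y) (m := 0)
    (fun y _ => by simpa using (hd y).fun_pow 2) hff'
    (by simpa using hlim.pow 2)
  calc f x ^ 2 = -∫ y in Ioi x, 2 * f y * f' y := by rw [key]; ring
    _ ≤ |∫ y in Ioi x, 2 * f y * f' y| := neg_le_abs _
    _ ≤ ∫ y in Ioi x, |2 * f y * f' y| := abs_integral_le_integral_abs
    _ ≤ ∫ y in Ioi x, (l * f y ^ 2 + l⁻¹ * f' y ^ 2) :=
        integral_mono hff'.abs (hint.mono_set hsub) hle
    _ ≤ ∫ y in Ioi (0 : ℝ), (l * f y ^ 2 + l⁻¹ * f' y ^ 2) :=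
        setIntegral_mono_set hint (Eventually.of_forall fun y => by positivity)
          hsub.eventuallyLE
    _ = _ := by
        rw [integral_add (hf.const_mul l) (hf'.const_mul l⁻¹), integral_const_mul,
          integral_const_mul]

end Sobolev

section EnergyAlgebra

lemma absorb_cross_terms {c M a b S D₁ D₂ : ℝ} (hc : 0 < c)
    (h1 : c * a ^ 2 ≤ D₁ + M * (S * a + S * b + S ^ 2))
    (h2 : c * b ^ 2 ≤ D₂ + M * (S * a + S * b + S ^ 2) + a ^ 2 + M * (a * b)) :
    c / 2 * b ^ 2 ≤ (2 + M ^ 2 / c) / c * D₁ + D₂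
      + (((2 + M ^ 2 / c) / c + 1) * M + (((2 + M ^ 2 / c) / c + 1) * M) ^ 2 / 4
        + (((2 + M ^ 2 / c) / c + 1) * M) ^ 2 / c) * S ^ 2 := by
  set K := (2 + M ^ 2 / c) / c with hK
  set N := (K + 1) * M with hN
  have hKpos : 0 ≤ K := by positivity
  have hKc : K * c = 2 + M ^ 2 / c := by rw [hK]; field_simp
  have h3 := mul_le_mul_of_nonneg_left h1 hKpos
  have e1 : K * (c * a ^ 2) = (2 + M ^ 2 / c) * a ^ 2 := by rw [← hKc]; ring
  have y1 : M * (a * b) ≤ M ^ 2 / c * a ^ 2 + c / 4 * b ^ 2 := by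
    have : M ^ 2 / c * a ^ 2 + c / 4 * b ^ 2 - M * (a * b)
        = (M * a - c / 2 * b) ^ 2 / c := by field_simp; ring
    have h : 0 ≤ (M * a - c / 2 * b) ^ 2 / c := by positivity
    linarith
  have y2 : N * (S * a) ≤ a ^ 2 + N ^ 2 / 4 * S ^ 2 := by nlinarith [sq_nonneg (a - N / 2 * S)]
  have y3 : N * (S * b) ≤ c / 4 * b ^ 2 + N ^ 2 / c * S ^ 2 := by
    have : c / 4 * b ^ 2 + N ^ 2 / c * S ^ 2 - N * (S * b)
        = (c / 2 * b - N * S) ^ 2 / c := by field_simp; ring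
    have h : 0 ≤ (c / 2 * b - N * S) ^ 2 / c := by positivity
    linarith
  have e2 : K * (M * (S * a + S * b + S ^ 2)) + M * (S * a + S * b + S ^ 2)
      = N * (S * a) + N * (S * b) + N * S ^ 2 := by rw [hN]; ring
  rw [e1, mul_add] at h3
  nlinarith [h3, h2, y1, y2, y3, e2]

lemma abs_mul_le_mul {x y X Y : ℝ} (hx : |x| ≤ X) (hy : |y| ≤ Y) : |x * y| ≤ X * Y := by
  rw [abs_mul]
  exact mul_le_mul hx hy (abs_nonneg _) ((abs_nonneg _).trans hx)

set_option maxHeartbeats 1000000 in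
/-- The pointwise divergence-form energy inequality for the capillary system, with weight `χ`;
the arguments are the values of the unknowns and of their derivatives at a point, and `g` is a
forcing term. -/
lemma exists_energy_inequality {μ κ i₀ I N₁ N₂ : ℝ} (hμ : 0 < μ) (hκ : 0 < κ) (hi₀ : 0 < i₀)
    (hN₁ : 0 ≤ N₁) (hN₂ : 0 ≤ N₂) (hI : 0 < I) :
    ∃ c > 0, ∃ K J : ℝ, ∀ χ χ' i v₁ v₂ v₃ u₁ u₂ u₃ uₜ uₜₓ g : ℝ,
      0 ≤ χ → χ ≤ 1 → χ' ^ 2 ≤ 4 * χ → i₀ ≤ i → i ≤ I → |v₁| ≤ N₁ →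
      |uₜ - μ * u₂ * i + κ * v₃ * i ^ 5| ≤ N₂ * (|v₁| + |v₂| + |u₁| + |g|) →
      c * (χ * v₃ ^ 2) ≤
        K * (-(χ * (u₁ * uₜₓ) + κ * χ * (v₂ * u₃ * i ^ 5) - 5 / 2 * κ * χ * (v₂ ^ 2 * u₁ * i ^ 6))
          + (χ' * (u₁ * uₜ) + χ * (u₂ * uₜ + u₁ * uₜₓ)
            + κ * (χ' * (v₂ * u₂ * i ^ 5) + χ * (v₃ * u₂ * i ^ 5 + v₂ * u₃ * i ^ 5
                - 5 * (v₂ * u₂ * v₁ * i ^ 6)))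
            - 5 / 2 * κ * (χ' * (v₁ * v₂ * u₁ * i ^ 6) + χ * (v₂ ^ 2 * u₁ * i ^ 6
                + v₁ * v₃ * u₁ * i ^ 6 + v₁ * v₂ * u₂ * i ^ 6
                - 6 * (v₁ ^ 2 * v₂ * u₁ * i ^ 7)))))
        + ((χ * (u₃ * u₁ + v₂ * uₜₓ))
          + (-(χ' * (v₂ * uₜ) + χ * (v₃ * uₜ + v₂ * uₜₓ))
            - (χ' * (u₁ * u₂) + χ * (u₂ ^ 2 + u₁ * u₃))))
        + J * (v₁ ^ 2 + v₂ ^ 2 + u₁ ^ 2 + g ^ 2) := by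
  set c := min (μ * i₀) (κ * i₀ ^ 5) with hc
  have hcpos : 0 < c := lt_min (by positivity) (by positivity)
  set M := 4 * μ * I + 8 * κ * I ^ 5 + 8 * N₂ + 20 * κ * N₁ * I ^ 6 + 15 * κ * N₁ ^ 2 * I ^ 7 + 2
    with hM
  set K := (2 + M ^ 2 / c) / c with hK
  set J := ((K + 1) * M + ((K + 1) * M) ^ 2 / 4 + ((K + 1) * M) ^ 2 / c) with hJ
  have hMpos : 0 ≤ M := by positivity
  have hJpos : 0 ≤ J := by positivity
  clear_value c M K J
  refine ⟨c / 2, by positivity, K, 4 * J, ?_⟩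
  intro χ χ' i v₁ v₂ v₃ u₁ u₂ u₃ uₜ uₜₓ g hχ0 hχ1 hχ' hi hiI hv₁ hL
  set L := uₜ - μ * u₂ * i + κ * v₃ * i ^ 5 with hLdef
  have huₜ : uₜ = μ * u₂ * i - κ * v₃ * i ^ 5 + L := by rw [hLdef]; ring
  set S := |v₁| + |v₂| + |u₁| + |g| with hS
  have hS0 : 0 ≤ S := by positivity
  have hipos : 0 < i := hi₀.trans_le hi
  set d := √χ with hd
  have hd0 : 0 ≤ d := Real.sqrt_nonneg _
  have hdd : d ^ 2 = χ := Real.sq_sqrt hχ0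
  have hd1 : d ≤ 1 := Real.sqrt_le_one.2 hχ1
  have hχd : χ ≤ d := by rw [← hdd, sq]; exact mul_le_of_le_one_left hd0 hd1
  have hχ'd : |χ'| ≤ 2 * d := abs_le_of_sq_le_sq (by rw [mul_pow, hdd]; linarith) (by positivity)
  set a := d * |u₂| with ha
  set b := d * |v₃| with hb
  have ha0 : 0 ≤ a := by positivity
  have hb0 : 0 ≤ b := by positivity
  have ha2 : a ^ 2 = χ * u₂ ^ 2 := by rw [ha, mul_pow, hdd, sq_abs]
  have hb2 : b ^ 2 = χ * v₃ ^ 2 := by rw [hb, mul_pow, hdd, sq_abs]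
  have q1 : |χ' * u₂| ≤ 2 * a := by
    rw [abs_mul, ha, ← mul_assoc]; gcongr
  have q2 : |χ' * v₃| ≤ 2 * b := by
    rw [abs_mul, hb, ← mul_assoc]; gcongr
  have q3 : |χ'| ≤ 2 := by linarith
  have q4 : |χ * u₂| ≤ a := by
    rw [abs_mul, abs_of_nonneg hχ0, ha]; gcongr
  have q5 : |χ * v₃| ≤ b := by
    rw [abs_mul, abs_of_nonneg hχ0, hb]; gcongr
  have q6 : |χ| ≤ 1 := by rwa [abs_of_nonneg hχ0]
  have q7 : |v₂| ≤ S := by rw [hS]; linarith [abs_nonneg v₁, abs_nonneg u₁, abs_nonneg g]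
  have q8 : |u₁| ≤ S := by rw [hS]; linarith [abs_nonneg v₁, abs_nonneg v₂, abs_nonneg g]
  have qi : ∀ k : ℕ, |i ^ k| ≤ I ^ k := by
    intro k; rw [abs_of_nonneg (by positivity)]; gcongr
  have qi1 : |i| ≤ I := by simpa using qi 1
  have qμ : |μ| ≤ μ := (abs_of_pos hμ).le
  have qκ : |κ| ≤ κ := (abs_of_pos hκ).le
  have mm := @abs_mul_le_mul
  have t1 := mm (mm (mm q1 q8) qμ) qi1
  have t2 := mm (mm (mm q2 q8) qκ) (qi 5)
  have t3 := mm (mm q3 q8) hL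
  have t4 := mm q4 hL
  have t5 := mm (mm (mm q1 q7) qκ) (qi 5)
  have t6 := mm (mm (mm (mm q4 q7) qκ) hv₁) (qi 6)
  have t7 := mm (mm (mm (mm (mm q3 q7) q8) qκ) hv₁) (qi 6)
  have t8 := mm (mm (mm (mm q5 q8) qκ) hv₁) (qi 6)
  have t10 := mm (mm (mm (mm (mm (mm q6 q7) q8) qκ) hv₁) hv₁) (qi 7)
  have s1 := mm (mm (mm q1 q7) qμ) qi1
  have s2 := mm (mm (mm q2 q7) qκ) (qi 5)
  have s3 := mm (mm q3 q7) hL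
  have s4 := mm q1 q8
  have s5 : |χ * v₃ * (μ * u₂ * i)| ≤ a * b * μ * I := by
    have : |χ * v₃ * (μ * u₂ * i)| = a * b * μ * i := by
      rw [ha, hb, ← hdd]
      simp only [abs_mul, abs_pow, abs_of_nonneg hd0, abs_of_pos hμ, abs_of_pos hipos]
      ring
    rw [this]; gcongr
  have s6 := mm q5 hL
  rw [abs_le] at t1 t2 t3 t4 t5 t6 t7 t8 t10 s1 s2 s3 s4 s5 s6
  have z1 : 0 ≤ S * a := by positivity
  have z2 : 0 ≤ S * b := by positivity
  have z3 : 0 ≤ S ^ 2 := by positivity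
  have z4 : 0 ≤ a * b := by positivity
  set D₁ := -(χ * (u₁ * uₜₓ) + κ * χ * (v₂ * u₃ * i ^ 5) - 5 / 2 * κ * χ * (v₂ ^ 2 * u₁ * i ^ 6))
          + (χ' * (u₁ * uₜ) + χ * (u₂ * uₜ + u₁ * uₜₓ)
            + κ * (χ' * (v₂ * u₂ * i ^ 5) + χ * (v₃ * u₂ * i ^ 5 + v₂ * u₃ * i ^ 5
                - 5 * (v₂ * u₂ * v₁ * i ^ 6)))
            - 5 / 2 * κ * (χ' * (v₁ * v₂ * u₁ * i ^ 6) + χ * (v₂ ^ 2 * u₁ * i ^ 6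
                + v₁ * v₃ * u₁ * i ^ 6 + v₁ * v₂ * u₂ * i ^ 6
                - 6 * (v₁ ^ 2 * v₂ * u₁ * i ^ 7)))) with hD₁
  set D₂ := (χ * (u₃ * u₁ + v₂ * uₜₓ))
          + (-(χ' * (v₂ * uₜ) + χ * (v₃ * uₜ + v₂ * uₜₓ))
            - (χ' * (u₁ * u₂) + χ * (u₂ ^ 2 + u₁ * u₃))) with hD₂
  clear_value L S d a b D₁ D₂
  have w1 : μ * i * (χ * u₂ ^ 2) = D₁
      - χ' * u₂ * u₁ * μ * i + χ' * v₃ * u₁ * κ * i ^ 5 - χ' * u₁ * L - χ * u₂ * L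
      - χ' * u₂ * v₂ * κ * i ^ 5 + 5 * (χ * u₂ * v₂ * κ * v₁ * i ^ 6)
      + 5 / 2 * (χ' * v₂ * u₁ * κ * v₁ * i ^ 6) + 5 / 2 * (χ * v₃ * u₁ * κ * v₁ * i ^ 6)
      + 5 / 2 * (χ * u₂ * v₂ * κ * v₁ * i ^ 6)
      - 15 * (χ * v₂ * u₁ * κ * v₁ * v₁ * i ^ 7) := by
    rw [hD₁, huₜ]; ring
  have w2 : κ * i ^ 5 * (χ * v₃ ^ 2) = D₂
      + χ' * u₂ * v₂ * μ * i - χ' * v₃ * v₂ * κ * i ^ 5 + χ' * v₂ * L + χ' * u₂ * u₁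
      + χ * u₂ ^ 2 + χ * v₃ * (μ * u₂ * i) + χ * v₃ * L := by
    rw [hD₂, huₜ]; ring
  have c1 : c * a ^ 2 ≤ μ * i * (χ * u₂ ^ 2) := by
    rw [ha2]; gcongr
    exact (hc.le.trans (min_le_left _ _)).trans (by gcongr)
  have c2 : c * b ^ 2 ≤ κ * i ^ 5 * (χ * v₃ ^ 2) := by
    rw [hb2]; gcongr
    exact (hc.le.trans (min_le_right _ _)).trans (by gcongr)
  have pI5 : 0 ≤ κ * I ^ 5 := by positivity
  have pI6 : 0 ≤ κ * N₁ * I ^ 6 := by positivity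
  have pI7 : 0 ≤ κ * N₁ ^ 2 * I ^ 7 := by positivity
  have pI1 : 0 ≤ μ * I := by positivity
  have h1 : c * a ^ 2 ≤ D₁ + M * (S * a + S * b + S ^ 2) := by
    refine c1.trans ?_
    have hsum : μ * i * (χ * u₂ ^ 2) ≤ D₁
        + (2 * (μ * I) + N₂ + 2 * (κ * I ^ 5) + 15 / 2 * (κ * N₁ * I ^ 6)) * (S * a)
        + (2 * (κ * I ^ 5) + 5 / 2 * (κ * N₁ * I ^ 6)) * (S * b)
        + (2 * N₂ + 5 * (κ * N₁ * I ^ 6) + 15 * (κ * N₁ ^ 2 * I ^ 7)) * S ^ 2 := by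
      rw [w1]
      linarith only [t1.1, t2.2, t3.1, t4.1, t5.1, t6.2, t7.2, t8.2, t10.1]
    refine hsum.trans ?_
    have g1 : (2 * (μ * I) + N₂ + 2 * (κ * I ^ 5) + 15 / 2 * (κ * N₁ * I ^ 6)) * (S * a)
        ≤ M * (S * a) := by
      gcongr; rw [hM]; linarith only [hN₂, pI1, pI5, pI6, pI7]
    have g2 : (2 * (κ * I ^ 5) + 5 / 2 * (κ * N₁ * I ^ 6)) * (S * b) ≤ M * (S * b) := by
      gcongr; rw [hM]; linarith only [hN₂, pI1, pI5, pI6, pI7]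
    have g3 : (2 * N₂ + 5 * (κ * N₁ * I ^ 6) + 15 * (κ * N₁ ^ 2 * I ^ 7)) * S ^ 2
        ≤ M * S ^ 2 := by
      gcongr; rw [hM]; linarith only [hN₂, pI1, pI5, pI6, pI7]
    linarith only [g1, g2, g3]
  have h2 : c * b ^ 2 ≤ D₂ + M * (S * a + S * b + S ^ 2) + a ^ 2 + M * (a * b) := by
    refine c2.trans ?_
    have hsum : κ * i ^ 5 * (χ * v₃ ^ 2) ≤ D₂ + (2 * (μ * I) + 2) * (S * a)
        + (2 * (κ * I ^ 5) + N₂) * (S * b) + 2 * N₂ * S ^ 2 + a ^ 2 + μ * I * (a * b) := by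
      rw [w2]
      linarith only [s1.2, s2.1, s3.2, s4.2, s5.2, s6.2, ha2]
    refine hsum.trans ?_
    have g1 : (2 * (μ * I) + 2) * (S * a) ≤ M * (S * a) := by
      gcongr; rw [hM]; linarith only [hN₂, pI1, pI5, pI6, pI7]
    have g2 : (2 * (κ * I ^ 5) + N₂) * (S * b) ≤ M * (S * b) := by
      gcongr; rw [hM]; linarith only [hN₂, pI1, pI5, pI6, pI7]
    have g3 : 2 * N₂ * S ^ 2 ≤ M * S ^ 2 := by
      gcongr; rw [hM]; linarith only [hN₂, pI1, pI5, pI6, pI7]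
    have g4 : μ * I * (a * b) ≤ M * (a * b) := by
      gcongr; rw [hM]; linarith only [hN₂, pI1, pI5, pI6, pI7]
    linarith only [g1, g2, g3, g4]
  have h3 := absorb_cross_terms hcpos h1 h2
  rw [← hK, ← hJ, hb2] at h3
  have hSsq : S ^ 2 ≤ 4 * (v₁ ^ 2 + v₂ ^ 2 + u₁ ^ 2 + g ^ 2) := by
    rw [hS, ← sq_abs v₁, ← sq_abs v₂, ← sq_abs u₁, ← sq_abs g]
    linarith only [sq_nonneg (|v₁| - |v₂|), sq_nonneg (|v₁| - |u₁|), sq_nonneg (|v₂| - |u₁|),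
      sq_nonneg (|v₁| - |g|), sq_nonneg (|v₂| - |g|), sq_nonneg (|u₁| - |g|)]
  refine h3.trans ?_
  rw [mul_comm 4 J, mul_assoc J 4]
  gcongr

end EnergyAlgebra

section Rectangle

lemma integrable_rect {F : ℝ → ℝ → ℝ} {R T : ℝ}
    (hF : ContinuousOn (Function.uncurry F) (Icc 0 R ×ˢ Icc 0 T)) :
    Integrable (Function.uncurry F)
      ((volume.restrict (Ioc 0 R)).prod (volume.restrict (Ioc 0 T))) := by
  rw [Measure.prod_restrict]
  exact (hF.integrableOn_compact (isCompact_Icc.prod isCompact_Icc)).mono_set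
    (Set.prod_mono Ioc_subset_Icc_self Ioc_subset_Icc_self)

lemma continuousOn_slice {F : ℝ → ℝ → ℝ} {R T : ℝ}
    (hF : ContinuousOn (Function.uncurry F) (Icc 0 R ×ˢ Icc 0 T)) {t : ℝ} (ht : t ∈ Icc 0 T) :
    ContinuousOn (fun x => F x t) (Icc 0 R) :=
  hF.comp (f := fun x : ℝ => (x, t)) (by fun_prop) fun _ hx => ⟨hx, ht⟩

lemma continuousOn_slice' {F : ℝ → ℝ → ℝ} {R T : ℝ}
    (hF : ContinuousOn (Function.uncurry F) (Icc 0 R ×ˢ Icc 0 T)) {x : ℝ} (hx : x ∈ Icc 0 R) :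
    ContinuousOn (fun t => F x t) (Icc 0 T) :=
  hF.comp (f := fun t : ℝ => (x, t)) (by fun_prop) fun _ ht => ⟨hx, ht⟩

lemma intervalIntegrable_integral_rect {F : ℝ → ℝ → ℝ} {R T : ℝ} (hR : 0 ≤ R) (hT : 0 ≤ T)
    (hF : ContinuousOn (Function.uncurry F) (Icc 0 R ×ˢ Icc 0 T)) :
    IntervalIntegrable (fun t => ∫ x in (0 : ℝ)..R, F x t) volume 0 T := by
  rw [intervalIntegrable_iff_integrableOn_Ioc_of_le hT]
  simp only [intervalIntegral.integral_of_le hR]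
  exact (integrable_rect hF).integral_prod_right

lemma integral_rect_mono {f g : ℝ → ℝ → ℝ} {R T : ℝ} (hR : 0 ≤ R) (hT : 0 ≤ T)
    (hf : ContinuousOn (Function.uncurry f) (Icc 0 R ×ˢ Icc 0 T))
    (hg : ContinuousOn (Function.uncurry g) (Icc 0 R ×ˢ Icc 0 T))
    (h : ∀ x ∈ Ioo 0 R, ∀ t ∈ Ioo 0 T, f x t ≤ g x t) :
    ∫ t in (0 : ℝ)..T, ∫ x in (0 : ℝ)..R, f x t ≤ ∫ t in (0 : ℝ)..T, ∫ x in (0 : ℝ)..R, g x t := by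
  refine intervalIntegral.integral_mono_on_of_le_Ioo hT
    (intervalIntegrable_integral_rect hR hT hf) (intervalIntegrable_integral_rect hR hT hg) ?_
  intro t ht
  have ht' := Ioo_subset_Icc_self ht
  exact intervalIntegral.integral_mono_on_of_le_Ioo hR
    ((continuousOn_slice hf ht').intervalIntegrable_of_Icc hR)
    ((continuousOn_slice hg ht').intervalIntegrable_of_Icc hR) fun x hx => h x hx t ht

lemma integral_rect_divergence {A A' B B' : ℝ → ℝ → ℝ} {R T : ℝ} (hR : 0 ≤ R) (hT : 0 ≤ T)
    (hA : ∀ x ∈ Icc 0 R, ∀ t ∈ Icc 0 T, HasDerivAt (fun r => A x r) (A' x t) t)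
    (hB : ∀ x ∈ Icc 0 R, ∀ t ∈ Icc 0 T, HasDerivAt (fun y => B y t) (B' x t) x)
    (hA' : ContinuousOn (Function.uncurry A') (Icc 0 R ×ˢ Icc 0 T))
    (hB' : ContinuousOn (Function.uncurry B') (Icc 0 R ×ˢ Icc 0 T)) :
    ∫ t in (0 : ℝ)..T, ∫ x in (0 : ℝ)..R, (A' x t + B' x t)
      = (∫ x in (0 : ℝ)..R, (A x T - A x 0)) + ∫ t in (0 : ℝ)..T, (B R t - B 0 t) := by
  have hinner : ∀ t ∈ uIcc 0 T, ∫ x in (0 : ℝ)..R, (A' x t + B' x t)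
      = (∫ x in (0 : ℝ)..R, A' x t) + ∫ x in (0 : ℝ)..R, B' x t := by
    intro t ht
    rw [uIcc_of_le hT] at ht
    exact intervalIntegral.integral_add
      ((continuousOn_slice hA' ht).intervalIntegrable_of_Icc hR)
      ((continuousOn_slice hB' ht).intervalIntegrable_of_Icc hR)
  rw [intervalIntegral.integral_congr hinner, intervalIntegral.integral_add
    (intervalIntegrable_integral_rect hR hT hA') (intervalIntegrable_integral_rect hR hT hB')]
  congr 1
  · have hswap : ∫ t in (0 : ℝ)..T, ∫ x in (0 : ℝ)..R, A' x t
        = ∫ x in (0 : ℝ)..R, ∫ t in (0 : ℝ)..T, A' x t := by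
      simp only [intervalIntegral.integral_of_le hR, intervalIntegral.integral_of_le hT]
      exact (integral_integral_swap (integrable_rect hA')).symm
    rw [hswap]
    refine intervalIntegral.integral_congr fun x hx => ?_
    rw [uIcc_of_le hR] at hx
    refine intervalIntegral.integral_eq_sub_of_hasDerivAt (fun t ht => ?_)
      ((continuousOn_slice' hA' hx).intervalIntegrable_of_Icc hT)
    rw [uIcc_of_le hT] at ht
    exact hA x hx t ht
  · refine intervalIntegral.integral_congr fun t ht => ?_
    rw [uIcc_of_le hT] at ht
    refine intervalIntegral.integral_eq_sub_of_hasDerivAt (f := fun y => B y t) (fun x hx => ?_)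
      ((continuousOn_slice hB' ht).intervalIntegrable_of_Icc hR)
    rw [uIcc_of_le hR] at hx
    exact hB x hx t ht

end Rectangle

section RectangleEnergy

lemma integral_rect_le_of_divergence {A A' B B' f E : ℝ → ℝ → ℝ} {R T : ℝ}
    (hR : 0 ≤ R) (hT : 0 ≤ T)
    (hA : ∀ x ∈ Icc 0 R, ∀ t ∈ Icc 0 T, HasDerivAt (fun r => A x r) (A' x t) t)
    (hB : ∀ x ∈ Icc 0 R, ∀ t ∈ Icc 0 T, HasDerivAt (fun y => B y t) (B' x t) x)
    (hA' : ContinuousOn (Function.uncurry A') (Icc 0 R ×ˢ Icc 0 T))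
    (hB' : ContinuousOn (Function.uncurry B') (Icc 0 R ×ˢ Icc 0 T))
    (hf : ContinuousOn (Function.uncurry f) (Icc 0 R ×ˢ Icc 0 T))
    (hE : ContinuousOn (Function.uncurry E) (Icc 0 R ×ˢ Icc 0 T))
    (h : ∀ x ∈ Ioo 0 R, ∀ t ∈ Ioo 0 T, f x t ≤ A' x t + B' x t + E x t) :
    ∫ t in (0 : ℝ)..T, ∫ x in (0 : ℝ)..R, f x t
      ≤ (∫ x in (0 : ℝ)..R, (A x T - A x 0)) + (∫ t in (0 : ℝ)..T, (B R t - B 0 t))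
        + ∫ t in (0 : ℝ)..T, ∫ x in (0 : ℝ)..R, E x t := by
  have hAB : ContinuousOn (Function.uncurry fun x t => A' x t + B' x t) (Icc 0 R ×ˢ Icc 0 T) :=
    hA'.add hB'
  refine (integral_rect_mono hR hT hf (hAB.add hE) (g := fun x t => A' x t + B' x t + E x t)
    h).trans_eq ?_
  rw [← integral_rect_divergence hR hT hA hB hA' hB', ← intervalIntegral.integral_add
    (intervalIntegrable_integral_rect hR hT hAB) (intervalIntegrable_integral_rect hR hT hE)]
  refine intervalIntegral.integral_congr fun t ht => ?_
  rw [uIcc_of_le hT] at ht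
  exact intervalIntegral.integral_add
    ((continuousOn_slice hAB ht).intervalIntegrable_of_Icc hR)
    ((continuousOn_slice hE ht).intervalIntegrable_of_Icc hR)

end RectangleEnergy

section WeightedEnergy

lemma hasDerivAt_weighted_energy {K κ χ t i' v' u' : ℝ} {i v u : ℝ → ℝ}
    (hi : HasDerivAt i (-i' * i t ^ 2) t) (hv : HasDerivAt v v' t) (hu : HasDerivAt u u' t) :
    HasDerivAt
      (fun r => K * (-(χ * (u r ^ 2 / 2) + κ * χ * (v r ^ 2 * i r ^ 5) / 2)) + χ * (v r * u r))
      (K * (-(χ * (u t * u') + κ * χ * (v t * v' * i t ^ 5)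
          - 5 / 2 * κ * χ * (v t ^ 2 * i' * i t ^ 6))) + χ * (v' * u t + v t * u')) t := by
  have h1 := ((hu.fun_pow 2).div_const 2).const_mul χ
  have h2 := (((hv.fun_pow 2).fun_mul (hi.fun_pow 5)).const_mul (κ * χ)).div_const 2
  have h3 := (((h1.fun_add h2).fun_neg).const_mul K).fun_add ((hv.fun_mul hu).const_mul χ)
  refine h3.congr_deriv ?_
  push_cast
  ring

lemma hasDerivAt_weighted_flux {K κ x χ' w' v₁' v₂' u₁' u₂' : ℝ} {χ i v₁ v₂ u₁ u₂ w : ℝ → ℝ}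
    (hχ : HasDerivAt χ χ' x) (hi : HasDerivAt i (-v₁ x * i x ^ 2) x)
    (hv₁ : HasDerivAt v₁ v₁' x) (hv₂ : HasDerivAt v₂ v₂' x)
    (hu₁ : HasDerivAt u₁ u₁' x) (hu₂ : HasDerivAt u₂ u₂' x) (hw : HasDerivAt w w' x) :
    HasDerivAt
      (fun y => K * (χ y * (u₁ y * w y) + κ * (χ y * (v₂ y * u₂ y * i y ^ 5))
        - 5 / 2 * κ * (χ y * (v₁ y * v₂ y * u₁ y * i y ^ 6)))
        + (-(χ y * (v₂ y * w y)) - χ y * (u₁ y * u₂ y)))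
      (K * (χ' * (u₁ x * w x) + χ x * (u₁' * w x + u₁ x * w')
          + κ * (χ' * (v₂ x * u₂ x * i x ^ 5) + χ x * (v₂' * u₂ x * i x ^ 5
            + v₂ x * u₂' * i x ^ 5 - 5 * (v₂ x * u₂ x * v₁ x * i x ^ 6)))
          - 5 / 2 * κ * (χ' * (v₁ x * v₂ x * u₁ x * i x ^ 6) + χ x * (v₁' * v₂ x * u₁ x * i x ^ 6
            + v₁ x * v₂' * u₁ x * i x ^ 6 + v₁ x * v₂ x * u₁' * i x ^ 6
            - 6 * (v₁ x ^ 2 * v₂ x * u₁ x * i x ^ 7))))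
        + (-(χ' * (v₂ x * w x) + χ x * (v₂' * w x + v₂ x * w'))
          - (χ' * (u₁ x * u₂ x) + χ x * (u₁' * u₂ x + u₁ x * u₂')))) x := by
  have h1 := hχ.fun_mul (hu₁.fun_mul hw)
  have h2 := (hχ.fun_mul ((hv₂.fun_mul hu₂).fun_mul (hi.fun_pow 5))).const_mul κ
  have h3 := (hχ.fun_mul (((hv₁.fun_mul hv₂).fun_mul hu₁).fun_mul (hi.fun_pow 6))).const_mul
    (5 / 2 * κ)
  have h4 := (hχ.fun_mul (hv₂.fun_mul hw)).fun_neg.fun_sub (hχ.fun_mul (hu₁.fun_mul hu₂))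
  refine ((((h1.fun_add h2).fun_sub h3).const_mul K).fun_add h4).congr_deriv ?_
  push_cast
  ring

lemma continuousOn_weighted_energy_deriv {S : Set (ℝ × ℝ)} {K κ : ℝ}
    {χ i i' v v' u u' : ℝ × ℝ → ℝ} (hχ : ContinuousOn χ S) (hi : ContinuousOn i S)
    (hi' : ContinuousOn i' S) (hv : ContinuousOn v S) (hv' : ContinuousOn v' S)
    (hu : ContinuousOn u S) (hu' : ContinuousOn u' S) :
    ContinuousOn (fun z => K * (-(χ z * (u z * u' z) + κ * χ z * (v z * v' z * i z ^ 5)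
          - 5 / 2 * κ * χ z * (v z ^ 2 * i' z * i z ^ 6)))
          + χ z * (v' z * u z + v z * u' z)) S := by
  fun_prop

lemma continuousOn_weighted_flux_deriv {S : Set (ℝ × ℝ)} {K κ : ℝ}
    {χ χ' i v₁ v₂ v₃ u₁ u₂ u₃ w w' : ℝ × ℝ → ℝ} (hχ : ContinuousOn χ S)
    (hχ' : ContinuousOn χ' S) (hi : ContinuousOn i S)
    (hv₁ : ContinuousOn v₁ S) (hv₂ : ContinuousOn v₂ S) (hv₃ : ContinuousOn v₃ S)
    (hu₁ : ContinuousOn u₁ S) (hu₂ : ContinuousOn u₂ S) (hu₃ : ContinuousOn u₃ S)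
    (hw : ContinuousOn w S) (hw' : ContinuousOn w' S) :
    ContinuousOn (fun z => K * (χ' z * (u₁ z * w z) + χ z * (u₂ z * w z + u₁ z * w' z)
          + κ * (χ' z * (v₂ z * u₂ z * i z ^ 5) + χ z * (v₃ z * u₂ z * i z ^ 5
            + v₂ z * u₃ z * i z ^ 5 - 5 * (v₂ z * u₂ z * v₁ z * i z ^ 6)))
          - 5 / 2 * κ * (χ' z * (v₁ z * v₂ z * u₁ z * i z ^ 6)
            + χ z * (v₂ z * v₂ z * u₁ z * i z ^ 6
            + v₁ z * v₃ z * u₁ z * i z ^ 6 + v₁ z * v₂ z * u₂ z * i z ^ 6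
            - 6 * (v₁ z ^ 2 * v₂ z * u₁ z * i z ^ 7))))
        + (-(χ' z * (v₂ z * w z) + χ z * (v₃ z * w z + v₂ z * w' z))
          - (χ' z * (u₁ z * u₂ z) + χ z * (u₂ z * u₂ z + u₁ z * u₃ z)))) S := by
  fun_prop

end WeightedEnergy

section InteriorEstimate

lemma abs_weighted_energy_le {K κ χ i v u I : ℝ} (hκ : 0 < κ) (hχ0 : 0 ≤ χ) (hχ1 : χ ≤ 1)
    (hi : 0 ≤ i) (hiI : i ≤ I) :
    |K * (-(χ * (u ^ 2 / 2) + κ * χ * (v ^ 2 * i ^ 5) / 2)) + χ * (v * u)|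
      ≤ (|K| * (1 + κ * I ^ 5) + 1) * (v ^ 2 + u ^ 2) := by
  have hI : 0 ≤ I := hi.trans hiI
  have h1 : |-(χ * (u ^ 2 / 2) + κ * χ * (v ^ 2 * i ^ 5) / 2)|
      ≤ (1 + κ * I ^ 5) * (v ^ 2 + u ^ 2) := by
    rw [abs_neg, abs_of_nonneg (by positivity)]
    have e1 : χ * (u ^ 2 / 2) ≤ 1 * (u ^ 2 / 2) := by gcongr
    have e2 : κ * χ * (v ^ 2 * i ^ 5) ≤ κ * 1 * (v ^ 2 * I ^ 5) := by gcongr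
    have e3 : 0 ≤ κ * I ^ 5 * u ^ 2 := by positivity
    have e4 : 0 ≤ κ * I ^ 5 * v ^ 2 := by positivity
    nlinarith only [e1, e2, e3, e4, sq_nonneg u, sq_nonneg v]
  have h2 : |χ * (v * u)| ≤ 1 * (v ^ 2 + u ^ 2) := by
    refine abs_mul_le_mul (by rwa [abs_of_nonneg hχ0]) ?_
    rw [abs_le]
    constructor <;> nlinarith only [sq_nonneg (u + v), sq_nonneg (u - v)]
  calc _ ≤ |K * (-(χ * (u ^ 2 / 2) + κ * χ * (v ^ 2 * i ^ 5) / 2))| + |χ * (v * u)| :=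
        abs_add_le _ _
    _ ≤ |K| * ((1 + κ * I ^ 5) * (v ^ 2 + u ^ 2)) + 1 * (v ^ 2 + u ^ 2) :=
        add_le_add (abs_mul_le_mul le_rfl h1) h2
    _ = _ := by ring

lemma hasDerivAt_quadratic_cutoff (R x : ℝ) :
    HasDerivAt (fun y => (1 - y / R) ^ 2) (-(2 * (1 - x / R) / R)) x := by
  refine ((((hasDerivAt_id x).div_const R).const_sub 1).fun_pow 2).congr_deriv ?_
  push_cast
  simp only [id]
  ring

set_option maxHeartbeats 1000000 in
/-- Interior regularity: the space-time `L²` norm of the third derivative of `v` is controlled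
uniformly in the length of the spatial interval. -/
lemma exists_bound_integral_sq_third {μ κ m M N₁ N₂ J₀ T : ℝ} {v u g : ℝ → ℝ → ℝ}
    (hμ : 0 < μ) (hκ : 0 < κ) (hm : 0 < m) (hN₁ : 0 ≤ N₁) (hN₂ : 0 ≤ N₂) (hT : 0 < T)
    (hvs : ContDiff ℝ (⊤ : ℕ∞) (Function.uncurry v))
    (hus : ContDiff ℝ (⊤ : ℕ∞) (Function.uncurry u))
    (hgc : Continuous (Function.uncurry g))
    (hbd : ∀ x ≥ 0, ∀ t ∈ Icc 0 T, m ≤ v x t ∧ v x t ≤ M)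
    (hvx : ∀ x ≥ 0, ∀ t ∈ Icc 0 T, |pdx v x t| ≤ N₁)
    (hmass : ∀ x > 0, ∀ t ∈ Ioo 0 T, pdt v x t = pdx u x t)
    (hmom : ∀ x > 0, ∀ t ∈ Ioo 0 T,
      |pdt u x t - μ * pdx (pdx u) x t * (v x t)⁻¹ + κ * pdx (pdx (pdx v)) x t * (v x t)⁻¹ ^ 5|
        ≤ N₂ * (|pdx v x t| + |pdx (pdx v) x t| + |pdx u x t| + |g x t|))
    (hJ : ∀ R ≥ 0, ∀ t ∈ Icc 0 T,
      ∫ x in (0 : ℝ)..R,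
        (pdx v x t ^ 2 + pdx (pdx v) x t ^ 2 + pdx u x t ^ 2 + g x t ^ 2) ≤ J₀) :
    ∃ B, ∀ R ≥ 1, ∫ t in (0 : ℝ)..T, ∫ x in (0 : ℝ)..R, pdx (pdx (pdx v)) x t ^ 2 ≤ B := by
  have h00 : (0 : ℝ) ∈ Icc 0 T := ⟨le_rfl, hT.le⟩
  have hTT : T ∈ Icc 0 T := ⟨hT.le, le_rfl⟩
  have hM : 0 < M := hm.trans_le ((hbd 0 le_rfl 0 h00).1.trans (hbd 0 le_rfl 0 h00).2)
  obtain ⟨c, hc, K, J, hpt⟩ := exists_energy_inequality (i₀ := M⁻¹) (I := m⁻¹) hμ hκ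
    (inv_pos.2 hM) hN₁ hN₂ (inv_pos.2 hm)
  have hv1s := contDiff_pdx hvs
  have hv2s := contDiff_pdx hv1s
  have hv3s := contDiff_pdx hv2s
  have hu1s := contDiff_pdx hus
  have hu2s := contDiff_pdx hu1s
  have hu3s := contDiff_pdx hu2s
  have hws := contDiff_pdt hus
  have hwxs := contDiff_pdx hws
  have hvts := contDiff_pdt hvs
  have hv2ts := contDiff_pdt hv2s
  have hu1ts := contDiff_pdt hu1s
  set i : ℝ → ℝ → ℝ := fun x t => (v x t)⁻¹ with hi
  have hv0 : ∀ x ≥ 0, ∀ t ∈ Icc 0 T, 0 < v x t := fun x hx t ht => hm.trans_le (hbd x hx t ht).1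
  have hit : ∀ x ≥ 0, ∀ t ∈ Icc 0 T, HasDerivAt (fun r => i x r) (-pdt v x t * i x t ^ 2) t := by
    intro x hx t ht
    refine ((hasDerivAt_pdt hvs x t).fun_inv (hv0 x hx t ht).ne').congr_deriv ?_
    rw [hi]; field_simp
  have hix : ∀ x ≥ 0, ∀ t ∈ Icc 0 T, HasDerivAt (fun y => i y t) (-pdx v x t * i x t ^ 2) x := by
    intro x hx t ht
    refine ((hasDerivAt_pdx hvs x t).fun_inv (hv0 x hx t ht).ne').congr_deriv ?_
    rw [hi]; field_simp
  have hic : ∀ R : ℝ, ContinuousOn (Function.uncurry i) (Icc 0 R ×ˢ Icc 0 T) := by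
    intro R
    exact hvs.continuous.continuousOn.inv₀ fun z hz => (hv0 z.1 hz.1.1 z.2 hz.2).ne'
  have hi0 : ∀ x ≥ 0, ∀ t ∈ Icc 0 T, M⁻¹ ≤ i x t ∧ i x t ≤ m⁻¹ := by
    intro x hx t ht
    exact ⟨inv_anti₀ (hv0 x hx t ht) (hbd x hx t ht).2, inv_anti₀ hm (hbd x hx t ht).1⟩
  set E : ℝ → ℝ → ℝ := fun x t =>
    pdx v x t ^ 2 + pdx (pdx v) x t ^ 2 + pdx u x t ^ 2 + g x t ^ 2 with hE
  have hEc : Continuous (Function.uncurry E) :=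
    (((hv1s.continuous.pow 2).add (hv2s.continuous.pow 2)).add
      (hu1s.continuous.pow 2)).add (hgc.pow 2)
  have hE0 : ∀ x t, 0 ≤ E x t := fun x t => by positivity
  set b : ℝ → ℝ := fun t => K * (1 * (pdx u 0 t * pdt u 0 t)
        + κ * (1 * (pdx (pdx v) 0 t * pdx (pdx u) 0 t * i 0 t ^ 5))
        - 5 / 2 * κ * (1 * (pdx v 0 t * pdx (pdx v) 0 t * pdx u 0 t * i 0 t ^ 6)))
        + (-(1 * (pdx (pdx v) 0 t * pdt u 0 t)) - 1 * (pdx u 0 t * pdx (pdx u) 0 t)) with hb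
  set CA := |K| * (1 + κ * m⁻¹ ^ 5) + 1 with hCA
  have hCA0 : 0 ≤ CA := by positivity
  refine ⟨4 * ((2 * CA * J₀ - (∫ t in (0 : ℝ)..T, b t) + |J| * (T * J₀)) / c), ?_⟩
  intro R₀ hR₀
  set R := 2 * R₀ with hR
  have hR1 : 1 ≤ R := by linarith
  have hRpos : 0 < R := by linarith
  clear_value R
  set χ : ℝ → ℝ := fun x => (1 - x / R) ^ 2 with hχ
  set χ' : ℝ → ℝ := fun x => -(2 * (1 - x / R) / R) with hχ'
  have hχc : Continuous χ := by fun_prop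
  have hχ'c : Continuous χ' := by fun_prop
  have hχd : ∀ x, HasDerivAt χ (χ' x) x := hasDerivAt_quadratic_cutoff R
  have hχ0 : ∀ x, 0 ≤ χ x := fun x => sq_nonneg _
  have hχ1 : ∀ x ∈ Icc 0 R, χ x ≤ 1 := by
    intro x hx
    have h1 : 0 ≤ x / R := div_nonneg hx.1 hRpos.le
    have h2 : x / R ≤ 1 := (div_le_one hRpos).2 hx.2
    exact pow_le_one₀ (by linarith) (by linarith)
  have hχχ : ∀ x, χ' x ^ 2 ≤ 4 * χ x := by
    intro x
    have : χ' x ^ 2 = 4 * χ x * (R ^ 2)⁻¹ := by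
      simp only [hχ, hχ']; field_simp; ring
    rw [this]
    exact mul_le_of_le_one_right (by have := hχ0 x; positivity)
      (inv_le_one_of_one_le₀ (one_le_pow₀ hR1))
  have hχR : χ R = 0 := by simp [hχ, hRpos.ne']
  have hχz : χ 0 = 1 := by simp [hχ]
  have hχhalf : ∀ x ∈ Icc 0 R₀, 1 / 4 ≤ χ x := by
    intro x hx
    have h1 : x / R ≤ 1 / 2 := by
      rw [div_le_iff₀ hRpos]; linarith [hx.2]
    simp only [hχ]
    nlinarith only [h1]
  clear_value χ χ'
  set A : ℝ → ℝ → ℝ := fun x t => K * (-(χ x * (pdx u x t ^ 2 / 2)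
      + κ * χ x * (pdx (pdx v) x t ^ 2 * i x t ^ 5) / 2)) + χ x * (pdx (pdx v) x t * pdx u x t)
    with hA
  set B : ℝ → ℝ → ℝ := fun x t => K * (χ x * (pdx u x t * pdt u x t)
        + κ * (χ x * (pdx (pdx v) x t * pdx (pdx u) x t * i x t ^ 5))
        - 5 / 2 * κ * (χ x * (pdx v x t * pdx (pdx v) x t * pdx u x t * i x t ^ 6)))
        + (-(χ x * (pdx (pdx v) x t * pdt u x t)) - χ x * (pdx u x t * pdx (pdx u) x t)) with hB
  have hAd : ∀ x ∈ Icc 0 R, ∀ t ∈ Icc 0 T, HasDerivAt (fun r => A x r) _ t := fun x hx t ht =>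
    hasDerivAt_weighted_energy (K := K) (κ := κ) (χ := χ x) (hit x hx.1 t ht)
      (hasDerivAt_pdt hv2s x t) (hasDerivAt_pdt hu1s x t)
  have hBd : ∀ x ∈ Icc 0 R, ∀ t ∈ Icc 0 T, HasDerivAt (fun y => B y t) _ x := fun x hx t ht =>
    hasDerivAt_weighted_flux (K := K) (κ := κ) (hχd x) (hix x hx.1 t ht)
      (hasDerivAt_pdx hv1s x t) (hasDerivAt_pdx hv2s x t) (hasDerivAt_pdx hu1s x t)
      (hasDerivAt_pdx hu2s x t) (hasDerivAt_pdx hws x t)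
  have hχfst : Continuous fun z : ℝ × ℝ => χ z.1 := hχc.comp continuous_fst
  have hχ'fst : Continuous fun z : ℝ × ℝ => χ' z.1 := hχ'c.comp continuous_fst
  have hAc := continuousOn_weighted_energy_deriv (K := K) (κ := κ) hχfst.continuousOn (hic R)
    hvts.continuous.continuousOn hv2s.continuous.continuousOn hv2ts.continuous.continuousOn
    hu1s.continuous.continuousOn hu1ts.continuous.continuousOn
  have hBc := continuousOn_weighted_flux_deriv (K := K) (κ := κ) hχfst.continuousOn
    hχ'fst.continuousOn (hic R) hv1s.continuous.continuousOn hv2s.continuous.continuousOn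
    hv3s.continuous.continuousOn hu1s.continuous.continuousOn hu2s.continuous.continuousOn
    hu3s.continuous.continuousOn hws.continuous.continuousOn hwxs.continuous.continuousOn
  have hJEc : ContinuousOn (Function.uncurry fun x t => |J| * E x t) (Icc 0 R ×ˢ Icc 0 T) :=
    (continuous_const.mul hEc).continuousOn
  have hfc : Continuous (Function.uncurry fun x t => c * (χ x * pdx (pdx (pdx v)) x t ^ 2)) :=
    continuous_const.mul (hχfst.mul (hv3s.continuous.pow 2))
  have hpt' : ∀ x ∈ Ioo 0 R, ∀ t ∈ Ioo 0 T, _ ≤ _ := fun x hx t ht =>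
    hpt (χ x) (χ' x) (i x t) (pdx v x t) (pdx (pdx v) x t) (pdx (pdx (pdx v)) x t) (pdx u x t)
      (pdx (pdx u) x t) (pdx (pdx (pdx u)) x t) (pdt u x t) (pdx (pdt u) x t) (g x t) (hχ0 x)
      (hχ1 x (Ioo_subset_Icc_self hx)) (hχχ x) (hi0 x hx.1.le t (Ioo_subset_Icc_self ht)).1
      (hi0 x hx.1.le t (Ioo_subset_Icc_self ht)).2 (hvx x hx.1.le t (Ioo_subset_Icc_self ht))
      (hmom x hx.1 t ht)
  have hmain := integral_rect_le_of_divergence hRpos.le hT.le hAd hBd hAc hBc hfc.continuousOn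
    hJEc (by
      intro x hx t ht
      have e1 : pdt v x t = pdx u x t := hmass x hx.1 t ht
      have e2 : pdt (pdx v) x t = pdx (pdx u) x t := by
        rw [pdt_pdx_comm hvs]
        exact pdx_congr_of_pos (fun y hy => hmass y hy t ht) hx.1
      have e3 : pdt (pdx (pdx v)) x t = pdx (pdx (pdx u)) x t := by
        rw [pdt_pdx_comm hv1s, pdt_pdx_comm hvs]
        refine pdx_congr_of_pos (fun y hy => ?_) hx.1
        exact pdx_congr_of_pos (fun y hy => hmass y hy t ht) hy
      have e4 : pdt (pdx u) x t = pdx (pdt u) x t := by rw [pdt_pdx_comm hus]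
      have hJle : J * E x t ≤ |J| * E x t :=
        mul_le_mul_of_nonneg_right (le_abs_self J) (hE0 x t)
      refine (hpt' x hx t ht).trans ((add_le_add_right hJle _).trans_eq ?_)
      simp only [e1, e3, e4]
      ring)
  have hBR : ∀ t, B R t - B 0 t = -b t := by
    intro t
    simp only [hB, hb, hχR, hχz]
    ring
  have hEint : ∀ t ∈ Icc 0 T, ∫ x in (0 : ℝ)..R, E x t ≤ J₀ := hJ R hRpos.le
  have hEs : ∀ t, Continuous fun x => E x t := fun t =>
    hEc.comp (by fun_prop : Continuous fun x : ℝ => (x, t))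
  have hAle : ∀ x ∈ Icc 0 R, ∀ t ∈ Icc 0 T, |A x t| ≤ CA * E x t := by
    intro x hx t ht
    have hi' := hi0 x hx.1 t ht
    refine (abs_weighted_energy_le hκ (hχ0 x) (hχ1 x hx) ((inv_pos.2 hM).le.trans hi'.1)
      hi'.2).trans (mul_le_mul_of_nonneg_left ?_ hCA0)
    simp only [hE]
    linarith only [sq_nonneg (pdx v x t), sq_nonneg (g x t)]
  have hApart : ∫ x in (0 : ℝ)..R, (A x T - A x 0) ≤ 2 * CA * J₀ := by
    have hCAi : ∀ t, IntervalIntegrable (fun x => CA * E x t) volume 0 R := fun t =>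
      (continuous_const.mul (hEs t)).intervalIntegrable _ _
    have hb1 : ∫ x in (0 : ℝ)..R, (A x T - A x 0)
        ≤ ∫ x in (0 : ℝ)..R, (CA * E x T + CA * E x 0) := by
      have hAcont : ∀ t ∈ Icc 0 T, ContinuousOn (fun x => A x t) (Icc 0 R) := by
        intro t ht
        have h1 := continuousOn_slice (hic R) ht
        have h2 := (continuous_slice_fst hu1s t).continuousOn (s := Icc 0 R)
        have h3 := (continuous_slice_fst hv2s t).continuousOn (s := Icc 0 R)
        have h4 := hχc.continuousOn (s := Icc 0 R)
        exact (continuousOn_const.mul ((h4.mul ((h2.pow 2).div_const 2)).add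
          (((continuousOn_const.mul h4).mul ((h3.pow 2).mul (h1.pow 5))).div_const 2)).neg).add
          (h4.mul (h3.mul h2))
      refine intervalIntegral.integral_mono_on hRpos.le
        (((hAcont T hTT).sub (hAcont 0 h00)).intervalIntegrable_of_Icc hRpos.le)
        ((hCAi T).add (hCAi 0)) ?_
      intro x hx
      linarith only [(abs_le.1 (hAle x hx T hTT)).2, (abs_le.1 (hAle x hx 0 h00)).1]
    rw [intervalIntegral.integral_add (hCAi T) (hCAi 0), intervalIntegral.integral_const_mul,
      intervalIntegral.integral_const_mul] at hb1
    have h1 := mul_le_mul_of_nonneg_left (hEint T hTT) hCA0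
    have h2 := mul_le_mul_of_nonneg_left (hEint 0 h00) hCA0
    linarith only [hb1, h1, h2]
  have hJpart : ∫ t in (0 : ℝ)..T, ∫ x in (0 : ℝ)..R, |J| * E x t ≤ |J| * (T * J₀) := by
    have h1 : ∫ t in (0 : ℝ)..T, ∫ x in (0 : ℝ)..R, E x t ≤ ∫ _ in (0 : ℝ)..T, J₀ :=
      intervalIntegral.integral_mono_on hT.le
        (intervalIntegrable_integral_rect hRpos.le hT.le hEc.continuousOn) (by simp) hEint
    simp only [intervalIntegral.integral_const, sub_zero, smul_eq_mul] at h1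
    simp only [intervalIntegral.integral_const_mul]
    exact mul_le_mul_of_nonneg_left h1 (abs_nonneg J)
  simp only [hBR, intervalIntegral.integral_neg, intervalIntegral.integral_const_mul]
    at hmain hJpart
  have hχint : ∫ t in (0 : ℝ)..T, ∫ x in (0 : ℝ)..R, χ x * pdx (pdx (pdx v)) x t ^ 2
      ≤ (2 * CA * J₀ - (∫ t in (0 : ℝ)..T, b t) + |J| * (T * J₀)) / c := by
    rw [le_div_iff₀' hc]
    linarith only [hmain, hJpart, hApart]
  have hχqc : Continuous (Function.uncurry fun x t => χ x * pdx (pdx (pdx v)) x t ^ 2) :=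
    hχfst.mul (hv3s.continuous.pow 2)
  have hqc : Continuous (Function.uncurry fun x t => pdx (pdx (pdx v)) x t ^ 2) :=
    hv3s.continuous.pow 2
  have hR₀0 : 0 ≤ R₀ := by linarith
  have hhalf : ∫ t in (0 : ℝ)..T, ∫ x in (0 : ℝ)..R₀, pdx (pdx (pdx v)) x t ^ 2
      ≤ ∫ t in (0 : ℝ)..T, 4 * ∫ x in (0 : ℝ)..R, χ x * pdx (pdx (pdx v)) x t ^ 2 := by
    refine intervalIntegral.integral_mono_on hT.le
      (intervalIntegrable_integral_rect hR₀0 hT.le hqc.continuousOn)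
      ((intervalIntegrable_integral_rect hRpos.le hT.le hχqc.continuousOn).const_mul 4) ?_
    intro t ht
    have hgt : Continuous fun x => χ x * pdx (pdx (pdx v)) x t ^ 2 :=
      hχc.mul ((continuous_slice_fst hv3s t).pow 2)
    have hle : ∫ x in (0 : ℝ)..R₀, pdx (pdx (pdx v)) x t ^ 2
        ≤ ∫ x in (0 : ℝ)..R₀, 4 * (χ x * pdx (pdx (pdx v)) x t ^ 2) := by
      refine intervalIntegral.integral_mono_on hR₀0
        (((continuous_slice_fst hv3s t).pow 2).intervalIntegrable _ _)
        ((continuous_const.mul hgt).intervalIntegrable _ _) fun x hx => ?_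
      have := mul_le_mul_of_nonneg_right (hχhalf x hx) (sq_nonneg (pdx (pdx (pdx v)) x t))
      linarith only [this]
    rw [intervalIntegral.integral_const_mul] at hle
    refine hle.trans (mul_le_mul_of_nonneg_left ?_ (by norm_num))
    exact intervalIntegral.integral_mono_interval le_rfl hR₀0 (by linarith)
      (Eventually.of_forall fun x => mul_nonneg (hχ0 x) (sq_nonneg _))
      (hgt.intervalIntegrable _ _)
  rw [intervalIntegral.integral_const_mul] at hhalf
  exact hhalf.trans (mul_le_mul_of_nonneg_left hχint (by norm_num))

end InteriorEstimate

section Integrability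

lemma intervalIntegrable_integral_Ioi_of_bounded {f : ℝ → ℝ → ℝ} {T B : ℝ} (hT : 0 ≤ T)
    (hf : Continuous (Function.uncurry f)) (hf0 : ∀ x t, 0 ≤ f x t)
    (hB : ∀ R ≥ 1, ∫ t in (0 : ℝ)..T, ∫ x in (0 : ℝ)..R, f x t ≤ B) :
    IntervalIntegrable (fun t => ∫ x in Ioi (0 : ℝ), f x t) volume 0 T := by
  rw [intervalIntegrable_iff_integrableOn_Ioc_of_le hT]
  set ν := ((volume.restrict (Ioi (0 : ℝ))).prod (volume.restrict (Ioc 0 T))) with hν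
  have hcover : AECover ν atTop (fun R : ℝ => Iic R ×ˢ (univ : Set ℝ)) :=
    ⟨Eventually.of_forall fun z => (eventually_ge_atTop z.1).mono fun R hR => ⟨hR, trivial⟩,
      fun R => measurableSet_Iic.prod MeasurableSet.univ⟩
  have hrestrict : ∀ R : ℝ, ν.restrict (Iic R ×ˢ univ)
      = (volume.restrict (Ioc 0 R)).prod (volume.restrict (Ioc 0 T)) := by
    intro R
    rw [hν, ← Measure.prod_restrict, Measure.restrict_univ, Measure.restrict_restrict
      measurableSet_Iic, inter_comm, Ioi_inter_Iic]
  have hint : ∀ R : ℝ, IntegrableOn (Function.uncurry f) (Iic R ×ˢ univ) ν := by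
    intro R
    rw [IntegrableOn, hrestrict]
    exact integrable_rect hf.continuousOn
  have h : Integrable (Function.uncurry f) ν := by
    refine hcover.integrable_of_integral_bounded_of_nonneg_ae B hint
      (Eventually.of_forall fun z => hf0 z.1 z.2) ?_
    filter_upwards [eventually_ge_atTop 1] with R hR
    have := hB R hR
    rw [hrestrict, integral_prod_symm _ (integrable_rect hf.continuousOn)]
    simp only [intervalIntegral.integral_of_le hT,
      intervalIntegral.integral_of_le (zero_le_one.trans hR)] at this
    exact this
  exact h.integral_prod_right

lemma integral_sq_le_of_exp_decay {W : ℝ → ℝ} {D c : ℝ} (hc : 0 < c) (hW : Continuous W)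
    (hdec : ∀ ξ, |W ξ| ≤ D * exp (-(c * |ξ|))) (a R : ℝ) (hR : 0 ≤ R) :
    ∫ x in (0 : ℝ)..R, W (x + a) ^ 2 ≤ D ^ 2 * exp (2 * c * |a|) / (2 * c) := by
  have hle : ∫ x in (0 : ℝ)..R, W (x + a) ^ 2
      ≤ ∫ x in (0 : ℝ)..R, D ^ 2 * exp (2 * c * |a|) * exp (-(2 * c) * x) := by
    refine intervalIntegral.integral_mono_on hR
      ((by fun_prop : Continuous fun x => W (x + a) ^ 2).intervalIntegrable _ _)
      ((by fun_prop : Continuous fun x =>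
        D ^ 2 * exp (2 * c * |a|) * exp (-(2 * c) * x)).intervalIntegrable _ _) fun x hx => ?_
    have h1 : W (x + a) ^ 2 ≤ (D * exp (-(c * |x + a|))) ^ 2 := by
      rw [← sq_abs]
      exact pow_le_pow_left₀ (abs_nonneg _) (hdec _) 2
    refine h1.trans ?_
    rw [mul_pow, ← exp_nat_mul, mul_assoc, ← exp_add]
    refine mul_le_mul_of_nonneg_left (exp_le_exp.2 ?_) (sq_nonneg D)
    have h2 : x ≤ |x + a| + |a| := by
      linarith [le_abs_self (x + a), neg_abs_le a]
    have h3 := mul_le_mul_of_nonneg_left h2 hc.le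
    push_cast
    linarith
  refine hle.trans ?_
  have hcne : -(2 * c) ≠ 0 := by linarith
  rw [intervalIntegral.integral_const_mul, intervalIntegral.integral_comp_mul_left _ hcne,
    integral_exp, div_eq_mul_inv]
  refine mul_le_mul_of_nonneg_left ?_ (by positivity)
  rw [mul_zero, exp_zero, smul_eq_mul, inv_neg]
  have h4 : 0 ≤ (2 * c)⁻¹ * exp (-(2 * c) * R) := by positivity
  linarith

lemma integral_sq_wave_add_le {W f : ℝ → ℝ} {D c a R : ℝ} (hc : 0 < c) (hW : Continuous W)
    (hdec : ∀ ξ, |W ξ| ≤ D * exp (-(c * |ξ|))) (hf : Continuous f)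
    (hfi : IntegrableOn (fun x => f x ^ 2) (Ioi 0)) (hR : 0 ≤ R) :
    ∫ x in (0 : ℝ)..R, (W (x + a) + f x) ^ 2
      ≤ D ^ 2 * exp (2 * c * |a|) / c + 2 * ∫ x in Ioi (0 : ℝ), f x ^ 2 := by
  have hi1 : IntervalIntegrable (fun x => 2 * W (x + a) ^ 2) volume 0 R :=
    (by fun_prop : Continuous fun x => 2 * W (x + a) ^ 2).intervalIntegrable _ _
  have hi2 : IntervalIntegrable (fun x => 2 * f x ^ 2) volume 0 R :=
    (by fun_prop : Continuous fun x => 2 * f x ^ 2).intervalIntegrable _ _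
  have hle : ∫ x in (0 : ℝ)..R, (W (x + a) + f x) ^ 2
      ≤ ∫ x in (0 : ℝ)..R, (2 * W (x + a) ^ 2 + 2 * f x ^ 2) := by
    refine intervalIntegral.integral_mono_on hR
      ((by fun_prop : Continuous fun x => (W (x + a) + f x) ^ 2).intervalIntegrable _ _)
      (hi1.add hi2) fun x _ => ?_
    nlinarith only [sq_nonneg (W (x + a) - f x)]
  rw [intervalIntegral.integral_add hi1 hi2, intervalIntegral.integral_const_mul,
    intervalIntegral.integral_const_mul] at hle
  have h1 := integral_sq_le_of_exp_decay hc hW hdec a R hR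
  have h2 : ∫ x in (0 : ℝ)..R, f x ^ 2 ≤ ∫ x in Ioi (0 : ℝ), f x ^ 2 := by
    rw [intervalIntegral.integral_of_le hR]
    exact setIntegral_mono_set hfi (Eventually.of_forall fun x => sq_nonneg _)
      Ioc_subset_Ioi_self.eventuallyLE
  have h3 : D ^ 2 * exp (2 * c * |a|) / c = 2 * (D ^ 2 * exp (2 * c * |a|) / (2 * c)) := by
    field_simp
  rw [h3]
  linarith

end Integrability

section Momentum

/-- The momentum equation in terms of the full unknowns, obtained from the perturbation equation
and the profile equation. -/
lemma momentum_of_profile {μ κ V w V₁ V₂ w₁ w₂ U₁ y z dp pV pv S pm : ℝ} (hV : 0 < V)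
    (hv : 0 < V + w)
    (hprof : μ * U₁ / V - κ * V₂ / V ^ 5 + (5 * κ / 2) * V₁ ^ 2 / V ^ 6 = -S + pV - pm)
    (heq : z + dp * w - μ / V * y + κ * w₂ / (V + w) ^ 5 + μ * U₁ * w / V ^ 2
      = -(pv - pV - dp * w) - μ * y * w / ((V + w) * V)
        + κ * V₂ * (1 / V ^ 5 - 1 / (V + w) ^ 5)
        + (5 * κ / 2) * (w₁ ^ 2 + 2 * w₁ * V₁) / (V + w) ^ 6
        + (5 * κ / 2) * V₁ ^ 2 * (1 / V ^ 6 - 1 / (V + w) ^ 6)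
        + μ * U₁ * w ^ 2 / ((V + w) * V ^ 2)) :
    z = -pv + μ * (U₁ + y) * (V + w)⁻¹ - κ * (V₂ + w₂) * (V + w)⁻¹ ^ 5
      + 5 / 2 * κ * ((V₁ + w₁) ^ 2 * (V + w)⁻¹ ^ 6) + S + pm
      + 5 * κ * (V₁ ^ 2 * (V⁻¹ ^ 6 - (V + w)⁻¹ ^ 6)) := by
  have hpV : pV = μ * U₁ / V - κ * V₂ / V ^ 5 + (5 * κ / 2) * V₁ ^ 2 / V ^ 6 + S + pm := by
    linarith
  have hz : z = -(dp * w) + μ / V * y - κ * w₂ / (V + w) ^ 5 - μ * U₁ * w / V ^ 2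
      + (-(pv - pV - dp * w) - μ * y * w / ((V + w) * V)
        + κ * V₂ * (1 / V ^ 5 - 1 / (V + w) ^ 5)
        + (5 * κ / 2) * (w₁ ^ 2 + 2 * w₁ * V₁) / (V + w) ^ 6
        + (5 * κ / 2) * V₁ ^ 2 * (1 / V ^ 6 - 1 / (V + w) ^ 6)
        + μ * U₁ * w ^ 2 / ((V + w) * V ^ 2)) := by
    linarith
  have hw : w = (V + w) - V := by ring
  rw [hz, hpV]
  generalize V + w = v at hv hw ⊢
  subst hw
  field_simp
  ring

lemma hasDerivAt_stress {p v v₁ v₂ u₁ V V₁ U : ℝ → ℝ} {μ κ s c x p' v₃ u₂ V₂ U₁ : ℝ}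
    (hp : HasDerivAt p p' (v x)) (hv : HasDerivAt v (v₁ x) x) (hv₁ : HasDerivAt v₁ (v₂ x) x)
    (hv₂ : HasDerivAt v₂ v₃ x) (hu₁ : HasDerivAt u₁ u₂ x) (hV : HasDerivAt V (V₁ x) x)
    (hV₁ : HasDerivAt V₁ V₂ x) (hU : HasDerivAt U U₁ x) (hv0 : v x ≠ 0) (hV0 : V x ≠ 0) :
    HasDerivAt (fun y => -p (v y) + μ * u₁ y * (v y)⁻¹ - κ * v₂ y * (v y)⁻¹ ^ 5
      + 5 / 2 * κ * (v₁ y ^ 2 * (v y)⁻¹ ^ 6) + s * U y + c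
      + 5 * κ * (V₁ y ^ 2 * ((V y)⁻¹ ^ 6 - (v y)⁻¹ ^ 6)))
      (μ * u₂ * (v x)⁻¹ - κ * v₃ * (v x)⁻¹ ^ 5 + s * U₁
        + (-(p' * v₁ x) - μ * (u₁ x * v₁ x * (v x)⁻¹ ^ 2) + 10 * κ * (v₁ x * v₂ x * (v x)⁻¹ ^ 6)
          - 15 * κ * (v₁ x * v₁ x * v₁ x * (v x)⁻¹ ^ 7)
          + 10 * κ * (V₁ x * V₂ * ((V x)⁻¹ ^ 6 - (v x)⁻¹ ^ 6))
          - 30 * κ * (V₁ x * V₁ x * V₁ x * (V x)⁻¹ ^ 7)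
          + 30 * κ * (V₁ x * V₁ x * v₁ x * (v x)⁻¹ ^ 7))) x := by
  have hi : HasDerivAt (fun y => (v y)⁻¹) (-v₁ x * (v x)⁻¹ ^ 2) x :=
    (hv.fun_inv hv0).congr_deriv (by field_simp)
  have hj : HasDerivAt (fun y => (V y)⁻¹) (-V₁ x * (V x)⁻¹ ^ 2) x :=
    (hV.fun_inv hV0).congr_deriv (by field_simp)
  have hpv : HasDerivAt (fun y => p (v y)) (p' * v₁ x) x := hp.comp x hv
  have h := ((((((hpv.fun_neg.fun_add ((hu₁.const_mul μ).fun_mul hi)).fun_sub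
    ((hv₂.const_mul κ).fun_mul (hi.fun_pow 5))).fun_add
    (((hv₁.fun_pow 2).fun_mul (hi.fun_pow 6)).const_mul (5 / 2 * κ))).fun_add
    (hU.const_mul s)).add_const c).fun_add
    (((hV₁.fun_pow 2).fun_mul ((hj.fun_pow 6).fun_sub (hi.fun_pow 6))).const_mul (5 * κ)))
  refine h.congr_deriv ?_
  push_cast
  ring

lemma abs_stress_remainder_le {μ κ p' v₁ v₂ u₁ V₁ V₂ i j P N D I : ℝ} (hμ : 0 < μ) (hκ : 0 < κ)
    (hp : |p'| ≤ P) (hv₁ : |v₁| ≤ N) (hV₁ : |V₁| ≤ D) (hV₂ : |V₂| ≤ D)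
    (hi : 0 ≤ i) (hiI : i ≤ I) (hj : 0 ≤ j) (hjI : j ≤ I) :
    |-(p' * v₁) - μ * (u₁ * v₁ * i ^ 2) + 10 * κ * (v₁ * v₂ * i ^ 6)
          - 15 * κ * (v₁ * v₁ * v₁ * i ^ 7) + 10 * κ * (V₁ * V₂ * (j ^ 6 - i ^ 6))
          - 30 * κ * (V₁ * V₁ * V₁ * j ^ 7) + 30 * κ * (V₁ * V₁ * v₁ * i ^ 7)|
      ≤ (P + μ * N * I ^ 2 + 10 * κ * N * I ^ 6 + 15 * κ * N ^ 2 * I ^ 7 + 10 * κ * D * I ^ 6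
        + 60 * κ * D ^ 2 * I ^ 7) * (|v₁| + |v₂| + |u₁| + |V₁|) := by
  have hN : 0 ≤ N := (abs_nonneg _).trans hv₁
  have hD : 0 ≤ D := (abs_nonneg _).trans hV₁
  have hP : 0 ≤ P := (abs_nonneg _).trans hp
  have hI : 0 ≤ I := hi.trans hiI
  have pi : ∀ k : ℕ, |i ^ k| ≤ I ^ k := fun k => by
    rw [abs_of_nonneg (by positivity)]; gcongr
  have pj : ∀ k : ℕ, |j ^ k| ≤ I ^ k := fun k => by
    rw [abs_of_nonneg (by positivity)]; gcongr
  have pji : |j ^ 6 - i ^ 6| ≤ I ^ 6 := by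
    have h1 := pow_le_pow_left₀ hi hiI 6
    have h2 := pow_le_pow_left₀ hj hjI 6
    have h3 := pow_nonneg hi 6
    have h4 := pow_nonneg hj 6
    rw [abs_le]
    constructor <;> linarith
  have mm := @abs_mul_le_mul
  have t1 := mm hp (le_refl |v₁|)
  have t2 := mm (mm (le_refl |u₁|) hv₁) (pi 2)
  have t3 := mm (mm hv₁ (le_refl |v₂|)) (pi 6)
  have t4 := mm (mm (mm hv₁ hv₁) (le_refl |v₁|)) (pi 7)
  have t5 := mm (mm (le_refl |V₁|) hV₂) pji
  have t6 := mm (mm (mm hV₁ hV₁) (le_refl |V₁|)) (pj 7)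
  have t7 := mm (mm (mm hV₁ hV₁) (le_refl |v₁|)) (pi 7)
  set S := |v₁| + |v₂| + |u₁| + |V₁| with hS
  have s1 : |v₁| ≤ S := by
    rw [hS]; linarith only [abs_nonneg v₂, abs_nonneg u₁, abs_nonneg V₁]
  have s2 : |v₂| ≤ S := by
    rw [hS]; linarith only [abs_nonneg v₁, abs_nonneg u₁, abs_nonneg V₁]
  have s3 : |u₁| ≤ S := by
    rw [hS]; linarith only [abs_nonneg v₂, abs_nonneg v₁, abs_nonneg V₁]
  have s4 : |V₁| ≤ S := by
    rw [hS]; linarith only [abs_nonneg v₂, abs_nonneg u₁, abs_nonneg v₁]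
  clear_value S
  have r1 : |p' * v₁| ≤ P * S := t1.trans (by gcongr)
  have r2 : |u₁ * v₁ * i ^ 2| ≤ S * N * I ^ 2 := t2.trans (by gcongr)
  have r3 : |v₁ * v₂ * i ^ 6| ≤ N * S * I ^ 6 := t3.trans (by gcongr)
  have r4 : |v₁ * v₁ * v₁ * i ^ 7| ≤ N * N * S * I ^ 7 := t4.trans (by gcongr)
  have r5 : |V₁ * V₂ * (j ^ 6 - i ^ 6)| ≤ S * D * I ^ 6 := t5.trans (by gcongr)
  have r6 : |V₁ * V₁ * V₁ * j ^ 7| ≤ D * D * S * I ^ 7 := t6.trans (by gcongr)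
  have r7 : |V₁ * V₁ * v₁ * i ^ 7| ≤ D * D * S * I ^ 7 := t7.trans (by gcongr)
  have q2 := mm (abs_of_pos hμ).le r2
  have q3 := mm (abs_of_pos hκ).le r3
  have q4 := mm (abs_of_pos hκ).le r4
  have q5 := mm (abs_of_pos hκ).le r5
  have q6 := mm (abs_of_pos hκ).le r6
  have q7 := mm (abs_of_pos hκ).le r7
  rw [abs_le] at r1 q2 q3 q4 q5 q6 q7 ⊢
  constructor
  · linarith only [r1.2, q2.2, q3.1, q4.2, q5.1, q6.2, q7.1]
  · linarith only [r1.1, q2.1, q3.2, q4.1, q5.2, q6.1, q7.2]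

end Momentum

section SobolevNorms

variable {f : ℝ → ℝ → ℝ} {t : ℝ}

lemma sqnorm_nonneg (f : ℝ → ℝ → ℝ) (t : ℝ) : 0 ≤ sqnorm f t :=
  integral_nonneg fun _ => sq_nonneg _

lemma Hsq_nonneg (k : ℕ) (f : ℝ → ℝ → ℝ) (t : ℝ) : 0 ≤ Hsq k f t :=
  Finset.sum_nonneg fun _ _ => sqnorm_nonneg _ _

lemma sqnorm_le_Hsq {j k : ℕ} (h : j ≤ k) : sqnorm (pdx^[j] f) t ≤ Hsq k f t :=
  Finset.single_le_sum (f := fun j => sqnorm (pdx^[j] f) t) (fun _ _ => sqnorm_nonneg _ _)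
    (Finset.mem_range.2 (Nat.lt_succ_of_le h))

lemma Hsq_one (f : ℝ → ℝ → ℝ) (t : ℝ) : Hsq 1 f t = sqnorm f t + sqnorm (pdx f) t := by
  simp [Hsq, Finset.sum_range_succ]

lemma sq_le_sqnorm (hf : ContDiff ℝ (⊤ : ℕ∞) (Function.uncurry f))
    (hfi : IntegrableOn (fun x => f x t ^ 2) (Ioi 0))
    (hfi' : IntegrableOn (fun x => pdx f x t ^ 2) (Ioi 0))
    (hlim : Tendsto (fun x => f x t) atTop (nhds 0)) {l : ℝ} (hl : 0 < l) {x : ℝ} (hx : 0 ≤ x) :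
    f x t ^ 2 ≤ l * sqnorm f t + l⁻¹ * sqnorm (pdx f) t :=
  sq_le_of_integrable_sq (fun y => hasDerivAt_pdx hf y t)
    (continuous_slice_fst (contDiff_pdx hf) t) hfi hfi' hlim hl hx

end SobolevNorms

section FourthDerivative

lemma exists_bound_deriv {p : ℝ → ℝ} (hp : ContDiffOn ℝ (⊤ : ℕ∞) p (Ioi 0)) {a : ℝ} (ha : 0 < a)
    (b : ℝ) : ∃ P > 0, ∀ v ∈ Icc a b, |deriv p v| ≤ P := by
  have hc : ContinuousOn (deriv p) (Icc a b) :=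
    (hp.continuousOn_deriv_of_isOpen isOpen_Ioi (by simp)).mono fun v hv => ha.trans_le hv.1
  obtain ⟨P, hP⟩ := isCompact_Icc.exists_bound_of_continuousOn hc
  exact ⟨max P 1, by positivity, fun v hv => (hP v hv).trans (le_max_left _ _)⟩

set_option maxHeartbeats 1000000 in
/-- The space-time norm of `∂ₓ⁴φ` is finite, although no such bound is assumed a priori. -/
lemma intervalIntegrable_sqnorm_fourth {p V U : ℝ → ℝ} {φ ψ : ℝ → ℝ → ℝ}
    {μ κ s c α β T D vm M : ℝ} (hp : ContDiffOn ℝ (⊤ : ℕ∞) p (Ioi 0))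
    (hμ : 0 < μ) (hκ : 0 < κ) (hs : 0 < s) (hc : 0 < c) (hvm : 0 < vm) (hT : 0 < T)
    (hV : ContDiff ℝ (⊤ : ℕ∞) V) (hU : ContDiff ℝ (⊤ : ℕ∞) U)
    (hVU : ∀ ξ, s * deriv V ξ + deriv U ξ = 0)
    (hprof : ∀ ξ : ℝ, μ * deriv U ξ / V ξ - κ * deriv (deriv V) ξ / (V ξ) ^ 5
            + (5 * κ / 2) * (deriv V ξ) ^ 2 / (V ξ) ^ 6 = -(s * U ξ) + p (V ξ) - p vm)
    (hVvm : ∀ ξ, vm ≤ V ξ)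
    (hV1 : ∀ ξ, |deriv V ξ| ≤ D * exp (-(c * |ξ|)))
    (hV2 : ∀ ξ, |deriv (deriv V) ξ| ≤ D * exp (-(c * |ξ|)))
    (hV3 : ∀ ξ, |deriv (deriv (deriv V)) ξ| ≤ D * exp (-(c * |ξ|)))
    (hU1 : ∀ ξ, |deriv U ξ| ≤ D * exp (-(c * |ξ|)))
    (hφ : ContDiff ℝ (⊤ : ℕ∞) (Function.uncurry φ))
    (hψ : ContDiff ℝ (⊤ : ℕ∞) (Function.uncurry ψ))
    (hφi : ∀ t ∈ Icc (0 : ℝ) T, ∀ j ≤ 4,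
      IntegrableOn (fun x => (pdx^[j] φ x t) ^ 2) (Ioi 0) ∧
      Tendsto (fun x => pdx^[j] φ x t) atTop (nhds 0))
    (hψi : ∀ t ∈ Icc (0 : ℝ) T, ∀ j ≤ 3,
      IntegrableOn (fun x => (pdx^[j] ψ x t) ^ 2) (Ioi 0) ∧
      Tendsto (fun x => pdx^[j] ψ x t) atTop (nhds 0))
    (hbd : ∀ x ≥ (0 : ℝ), ∀ t ∈ Icc (0 : ℝ) T,
      vm / 2 ≤ V (x - s * t + α - β) + pdx φ x t ∧ V (x - s * t + α - β) + pdx φ x t ≤ M)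
    (hmass : ∀ x ∈ Ioi (0 : ℝ), ∀ t ∈ Ioo (0 : ℝ) T, pdt φ x t - pdx ψ x t = 0)
    (hmom : ∀ x ∈ Ioi (0 : ℝ), ∀ t ∈ Ioo (0 : ℝ) T,
      pdt ψ x t + deriv p (V (x - s * t + α - β)) * pdx φ x t
        - μ / V (x - s * t + α - β) * pdx (pdx ψ) x t
        + κ * pdx (pdx (pdx φ)) x t / (V (x - s * t + α - β) + pdx φ x t) ^ 5
        + μ * deriv U (x - s * t + α - β) * pdx φ x t / (V (x - s * t + α - β)) ^ 2
      = NSKF p μ κ s α β V U φ ψ x t)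
    (hφn : ∀ t ∈ Icc (0 : ℝ) T, ∀ j ≤ 3, sqnorm (pdx^[j] φ) t ≤ 1)
    (hψn : ∀ t ∈ Icc (0 : ℝ) T, ∀ j ≤ 2, sqnorm (pdx^[j] ψ) t ≤ 1) :
    IntervalIntegrable (sqnorm (pdx^[4] φ)) volume 0 T := by
  have hm : 0 < vm / 2 := by positivity
  obtain ⟨P, hP0, hP⟩ := exists_bound_deriv hp hm M
  have hV1s := contDiff_deriv hV
  have hV2s := contDiff_deriv hV1s
  have hV3s := contDiff_deriv hV2s
  have hU1s := contDiff_deriv hU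
  have hφ1 := contDiff_pdx hφ
  have hφ2 := contDiff_pdx hφ1
  have hφ3 := contDiff_pdx hφ2
  have hφ4 := contDiff_pdx hφ3
  have hψ1 := contDiff_pdx hψ
  have hψ2 := contDiff_pdx hψ1
  set v : ℝ → ℝ → ℝ := fun x t => V (x - s * t + α - β) + pdx φ x t with hv
  set u : ℝ → ℝ → ℝ := fun x t => U (x - s * t + α - β) + pdx ψ x t with hu
  have hvs : ContDiff ℝ (⊤ : ℕ∞) (Function.uncurry v) := contDiff_wave_add s α β hV hφ1
  have hus : ContDiff ℝ (⊤ : ℕ∞) (Function.uncurry u) := contDiff_wave_add s α β hU hψ1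
  have ev1 : pdx v = fun x t => deriv V (x - s * t + α - β) + pdx (pdx φ) x t :=
    pdx_wave_add s α β hV hφ1
  have ev2 : pdx (pdx v)
      = fun x t => deriv (deriv V) (x - s * t + α - β) + pdx (pdx (pdx φ)) x t := by
    rw [ev1]; exact pdx_wave_add s α β hV1s hφ2
  have ev3 : pdx (pdx (pdx v))
      = fun x t => deriv (deriv (deriv V)) (x - s * t + α - β) + pdx (pdx (pdx (pdx φ))) x t := by
    rw [ev2]; exact pdx_wave_add s α β hV2s hφ3
  have eu1 : pdx u = fun x t => deriv U (x - s * t + α - β) + pdx (pdx ψ) x t :=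
    pdx_wave_add s α β hU hψ1
  have evt : pdt v = fun x t => -s * deriv V (x - s * t + α - β) + pdt (pdx φ) x t :=
    pdt_wave_add s α β hV hφ1
  have eut : pdt u = fun x t => -s * deriv U (x - s * t + α - β) + pdt (pdx ψ) x t :=
    pdt_wave_add s α β hU hψ1
  have hv1s := contDiff_pdx hvs
  have hv2s := contDiff_pdx hv1s
  have hv3s := contDiff_pdx hv2s
  have hu1s := contDiff_pdx hus
  have hD : 0 ≤ D := by
    have := (abs_nonneg _).trans (hV1 0)
    simpa using this
  have hdec : ∀ {W : ℝ → ℝ}, (∀ ξ, |W ξ| ≤ D * exp (-(c * |ξ|))) → ∀ ξ, |W ξ| ≤ D := by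
    intro W hW ξ
    refine (hW ξ).trans (mul_le_of_le_one_right hD (exp_le_one_iff.2 ?_))
    have := mul_nonneg hc.le (abs_nonneg ξ)
    linarith
  set g : ℝ → ℝ → ℝ := fun x t => deriv V (x - s * t + α - β) with hg
  have hgc : Continuous (Function.uncurry g) :=
    hV1s.continuous.comp (by fun_prop : Continuous fun z : ℝ × ℝ => z.1 - s * z.2 + α - β)
  have hvx : ∀ x ≥ 0, ∀ t ∈ Icc 0 T, |pdx v x t| ≤ D + 2 := by
    intro x hx t ht
    have h1 := sq_le_sqnorm hφ2 (hφi t ht 2 (by norm_num)).1 (hφi t ht 3 (by norm_num)).1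
      (hφi t ht 2 (by norm_num)).2 one_pos hx
    have h2 := hφn t ht 2 (by norm_num)
    have h3 := hφn t ht 3 (by norm_num)
    have h4 : pdx (pdx φ) x t ^ 2 ≤ 2 ^ 2 := by
      refine h1.trans ?_
      change sqnorm (pdx (pdx φ)) t ≤ 1 at h2
      change sqnorm (pdx (pdx (pdx φ))) t ≤ 1 at h3
      rw [inv_one]
      linarith
    have h5 := abs_le_of_sq_le_sq h4 (by norm_num)
    rw [ev1]
    exact (abs_add_le _ _).trans (add_le_add (hdec hV1 _) h5)
  have hmass' : ∀ x > 0, ∀ t ∈ Ioo 0 T, pdt v x t = pdx u x t := by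
    intro x hx t ht
    have h1 : pdt (pdx φ) x t = pdx (pdx ψ) x t := by
      rw [pdt_pdx_comm hφ]
      exact pdx_congr_of_pos (fun y hy => sub_eq_zero.1 (hmass y hy t ht)) hx
    rw [evt, eu1]
    simp only [h1]
    linarith [hVU (x - s * t + α - β)]
  have hstress : ∀ x > 0, ∀ t ∈ Ioo 0 T, pdt ψ x t = -p (v x t) + μ * pdx u x t * (v x t)⁻¹
      - κ * pdx (pdx v) x t * (v x t)⁻¹ ^ 5 + 5 / 2 * κ * (pdx v x t ^ 2 * (v x t)⁻¹ ^ 6)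
      + s * U (x - s * t + α - β) + p vm
      + 5 * κ * (deriv V (x - s * t + α - β) ^ 2
        * ((V (x - s * t + α - β))⁻¹ ^ 6 - (v x t)⁻¹ ^ 6)) := by
    intro x hx t ht
    rw [ev2, ev1, eu1]
    exact momentum_of_profile (hvm.trans_le (hVvm _))
      (hm.trans_le (hbd x (le_of_lt hx) t (Ioo_subset_Icc_self ht)).1) (hprof _) (hmom x hx t ht)
  set N₂ := P + μ * (D + 2) * (vm / 2)⁻¹ ^ 2 + 10 * κ * (D + 2) * (vm / 2)⁻¹ ^ 6
    + 15 * κ * (D + 2) ^ 2 * (vm / 2)⁻¹ ^ 7 + 10 * κ * D * (vm / 2)⁻¹ ^ 6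
    + 60 * κ * D ^ 2 * (vm / 2)⁻¹ ^ 7 with hN₂
  have hmom' : ∀ x > 0, ∀ t ∈ Ioo 0 T,
      |pdt u x t - μ * pdx (pdx u) x t * (v x t)⁻¹ + κ * pdx (pdx (pdx v)) x t * (v x t)⁻¹ ^ 5|
        ≤ N₂ * (|pdx v x t| + |pdx (pdx v) x t| + |pdx u x t| + |g x t|) := by
    intro x hx t ht
    have ht' := Ioo_subset_Icc_self ht
    have hbdx := hbd x hx.le t ht'
    have hvpos : 0 < v x t := hm.trans_le hbdx.1
    have hVpos : 0 < V (x - s * t + α - β) := hvm.trans_le (hVvm _)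
    have hshift : ∀ {W : ℝ → ℝ}, ContDiff ℝ (⊤ : ℕ∞) W →
        HasDerivAt (fun y => W (y - s * t + α - β)) (deriv W (x - s * t + α - β)) x := by
      intro W hW
      have h1 : HasDerivAt (fun y => y - s * t + α - β) 1 x :=
        (((hasDerivAt_id x).sub_const _).add_const _).sub_const _
      have h2 : HasDerivAt W (deriv W (x - s * t + α - β)) (x - s * t + α - β) :=
        (hW.differentiable (by simp) _).hasDerivAt
      exact (h2.comp x h1).congr_deriv (mul_one _)
    have hpd : HasDerivAt p (deriv p (v x t)) (v x t) :=
      ((hp.differentiableOn (by simp)).differentiableAt (Ioi_mem_nhds hvpos)).hasDerivAt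
    have hG := hasDerivAt_stress (μ := μ) (κ := κ) (s := s) (c := p vm)
      (v := fun y => v y t) (v₁ := fun y => pdx v y t) (v₂ := fun y => pdx (pdx v) y t)
      (x := x) hpd (hasDerivAt_pdx hvs x t) (hasDerivAt_pdx hv1s x t)
      (hasDerivAt_pdx hv2s x t) (hasDerivAt_pdx hu1s x t) (hshift hV) (hshift hV1s)
      (hshift hU) hvpos.ne' hVpos.ne'
    have hψt := hG.congr_of_eventuallyEq (f₁ := fun y => pdt ψ y t)
      (eventually_of_mem (Ioi_mem_nhds hx) fun y hy => hstress y hy t ht)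
    have hpt : pdt (pdx ψ) x t = _ := (congrFun (congrFun (pdt_pdx_comm hψ) x) t).trans hψt.deriv
    have hi := inv_anti₀ hm hbdx.1
    have hj := inv_anti₀ hm ((half_le_self hvm.le).trans (hVvm (x - s * t + α - β)))
    refine le_of_eq_of_le ?_ (abs_stress_remainder_le (i := (v x t)⁻¹)
      (j := (V (x - s * t + α - β))⁻¹) (v₂ := pdx (pdx v) x t) (u₁ := pdx u x t)
      hμ hκ (hP (v x t) hbdx) (hvx x hx.le t ht') (hdec hV1 _)
      (hdec hV2 (x - s * t + α - β)) (inv_pos.2 hvpos).le hi (inv_pos.2 hVpos).le hj)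
    congr 1
    rw [eut]
    simp only [hpt, hg]
    ring
  have hshift : ∀ x t, x - s * t + α - β = x + (-(s * t) + α - β) := fun x t => by ring
  set Jw := D ^ 2 * exp (2 * c * (s * T + |α - β|)) / c with hJw
  have hw : ∀ {W : ℝ → ℝ} {f : ℝ → ℝ → ℝ} {t R : ℝ}, Continuous W →
      (∀ ξ, |W ξ| ≤ D * exp (-(c * |ξ|))) → ContDiff ℝ (⊤ : ℕ∞) (Function.uncurry f) →
      IntegrableOn (fun x => f x t ^ 2) (Ioi 0) → sqnorm f t ≤ 1 → t ∈ Icc 0 T → 0 ≤ R →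
      ∫ x in (0 : ℝ)..R, (W (x - s * t + α - β) + f x t) ^ 2 ≤ Jw + 2 := by
    intro W f t R hW hWd hf hfi hf1 ht hR
    simp only [hshift]
    refine (integral_sq_wave_add_le hc hW hWd (continuous_slice_fst hf t) hfi hR).trans ?_
    have hexp : D ^ 2 * exp (2 * c * |-(s * t) + α - β|) / c ≤ Jw := by
      have h1 : |-(s * t) + α - β| ≤ s * T + |α - β| := by
        have h2 : |-(s * t) + (α - β)| ≤ |-(s * t)| + |α - β| := abs_add_le _ _
        rw [abs_neg, abs_of_nonneg (mul_nonneg hs.le ht.1), ← add_sub_assoc] at h2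
        exact h2.trans (by have := ht.2; gcongr)
      rw [hJw]
      gcongr
    have hf2 : ∫ x in Ioi (0 : ℝ), f x t ^ 2 ≤ 1 := hf1
    linarith
  have hzero : ContDiff ℝ (⊤ : ℕ∞) (Function.uncurry fun _ _ : ℝ => (0 : ℝ)) := contDiff_const
  have hw0 : ∀ {W : ℝ → ℝ} {t R : ℝ}, Continuous W → (∀ ξ, |W ξ| ≤ D * exp (-(c * |ξ|))) →
      t ∈ Icc 0 T → 0 ≤ R → ∫ x in (0 : ℝ)..R, W (x - s * t + α - β) ^ 2 ≤ Jw + 2 := by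
    intro W t R hW hWd ht hR
    simpa using hw hW hWd hzero (by simp) (by simp [sqnorm]) ht hR
  have hJ : ∀ R ≥ 0, ∀ t ∈ Icc 0 T,
      ∫ x in (0 : ℝ)..R, (pdx v x t ^ 2 + pdx (pdx v) x t ^ 2 + pdx u x t ^ 2 + g x t ^ 2)
        ≤ 4 * (Jw + 2) := by
    intro R hR t ht
    have i1 : IntervalIntegrable (fun x => pdx v x t ^ 2) volume 0 R :=
      ((continuous_slice_fst hv1s t).pow 2).intervalIntegrable _ _
    have i2 : IntervalIntegrable (fun x => pdx (pdx v) x t ^ 2) volume 0 R :=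
      ((continuous_slice_fst hv2s t).pow 2).intervalIntegrable _ _
    have i3 : IntervalIntegrable (fun x => pdx u x t ^ 2) volume 0 R :=
      ((continuous_slice_fst hu1s t).pow 2).intervalIntegrable _ _
    have i4 : IntervalIntegrable (fun x => g x t ^ 2) volume 0 R :=
      ((hgc.comp (by fun_prop : Continuous fun x : ℝ => (x, t))).pow 2).intervalIntegrable _ _
    rw [intervalIntegral.integral_add ((i1.add i2).add i3) i4,
      intervalIntegral.integral_add (i1.add i2) i3, intervalIntegral.integral_add i1 i2]
    have b1 := hw hV1s.continuous hV1 hφ2 (hφi t ht 2 (by norm_num)).1 (hφn t ht 2 (by norm_num))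
      ht hR
    have b2 := hw hV2s.continuous hV2 hφ3 (hφi t ht 3 (by norm_num)).1 (hφn t ht 3 (by norm_num))
      ht hR
    have b3 := hw hU1s.continuous hU1 hψ2 (hψi t ht 2 (by norm_num)).1 (hψn t ht 2 (by norm_num))
      ht hR
    have b4 := hw0 hV1s.continuous hV1 ht hR
    rw [ev2, ev1, eu1]
    linarith
  obtain ⟨B, hB⟩ := exists_bound_integral_sq_third hμ hκ hm (by positivity) (by positivity) hT hvs
    hus hgc hbd hvx hmass' hmom' hJ
  have hφ4c : Continuous (Function.uncurry fun x t => pdx (pdx (pdx (pdx φ))) x t ^ 2) :=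
    hφ4.continuous.pow 2
  refine intervalIntegrable_integral_Ioi_of_bounded (B := 2 * B + 2 * (T * (Jw + 2))) hT.le hφ4c
    (fun _ _ => sq_nonneg _) fun R hR => ?_
  have hR0 : 0 ≤ R := zero_le_one.trans hR
  have hv3c : Continuous (Function.uncurry fun x t => pdx (pdx (pdx v)) x t ^ 2) :=
    hv3s.continuous.pow 2
  have hslice : ∀ t ∈ Icc 0 T, ∫ x in (0 : ℝ)..R, pdx (pdx (pdx (pdx φ))) x t ^ 2
      ≤ 2 * (∫ x in (0 : ℝ)..R, pdx (pdx (pdx v)) x t ^ 2) + 2 * (Jw + 2) := by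
    intro t ht
    have i1 : IntervalIntegrable (fun x => 2 * pdx (pdx (pdx v)) x t ^ 2) volume 0 R :=
      (continuous_const.mul ((continuous_slice_fst hv3s t).pow 2)).intervalIntegrable _ _
    have i2 : IntervalIntegrable
        (fun x => 2 * deriv (deriv (deriv V)) (x - s * t + α - β) ^ 2) volume 0 R :=
      (continuous_const.mul ((hV3s.continuous.comp (by fun_prop :
        Continuous fun x : ℝ => x - s * t + α - β)).pow 2)).intervalIntegrable _ _
    have h1 : ∫ x in (0 : ℝ)..R, pdx (pdx (pdx (pdx φ))) x t ^ 2
        ≤ ∫ x in (0 : ℝ)..R, (2 * pdx (pdx (pdx v)) x t ^ 2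
          + 2 * deriv (deriv (deriv V)) (x - s * t + α - β) ^ 2) := by
      refine intervalIntegral.integral_mono_on hR0
        (((continuous_slice_fst hφ4 t).pow 2).intervalIntegrable _ _) (i1.add i2) fun x _ => ?_
      rw [ev3]
      nlinarith only [sq_nonneg (2 * deriv (deriv (deriv V)) (x - s * t + α - β)
        + pdx (pdx (pdx (pdx φ))) x t)]
    rw [intervalIntegral.integral_add i1 i2, intervalIntegral.integral_const_mul,
      intervalIntegral.integral_const_mul] at h1
    have h2 := hw0 hV3s.continuous hV3 ht hR0
    linarith
  have hint := intervalIntegrable_integral_rect hR0 hT.le hv3c.continuousOn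
  have hfin := intervalIntegral.integral_mono_on hT.le
    (intervalIntegrable_integral_rect hR0 hT.le hφ4c.continuousOn)
    ((hint.const_mul 2).add (intervalIntegrable_const (c := 2 * (Jw + 2)))) hslice
  rw [intervalIntegral.integral_add (hint.const_mul 2) intervalIntegrable_const,
    intervalIntegral.integral_const_mul, intervalIntegral.integral_const, smul_eq_mul] at hfin
  have hBR := hB R hR
  have hring : (T - 0) * (2 * (Jw + 2)) = 2 * (T * (Jw + 2)) := by ring
  rw [hring] at hfin
  exact hfin.trans (by linarith)

end FourthDerivative

section BoundaryTerms

lemma abs_integral_mul_trace_le {f : ℝ → ℝ → ℝ} {q : ℝ → ℝ} {P η t : ℝ} (hP : 0 < P) (hη : 0 < η)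
    (ht : 0 ≤ t) (hf : ContDiff ℝ (⊤ : ℕ∞) (Function.uncurry f))
    (hfi : ∀ τ ∈ Icc 0 t, ∀ j ≤ 2, IntegrableOn (fun x => (pdx^[j] f x τ) ^ 2) (Ioi 0) ∧
      Tendsto (fun x => pdx^[j] f x τ) atTop (nhds 0))
    (hq : ∀ τ, |q τ| ≤ P) (hf2 : IntervalIntegrable (sqnorm (pdx^[2] f)) volume 0 t)
    (hf1 : IntervalIntegrable (Hsq 1 f) volume 0 t) :
    |∫ τ in (0 : ℝ)..t, q τ * f 0 τ * pdx f 0 τ|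
      ≤ η * (∫ τ in (0 : ℝ)..t, sqnorm (pdx^[2] f) τ)
        + P / 2 * (1 + P / (2 * η)) * ∫ τ in (0 : ℝ)..t, Hsq 1 f τ := by
  have hl : 0 < P / (2 * η) := by positivity
  rw [← intervalIntegral.integral_const_mul, ← intervalIntegral.integral_const_mul,
    ← intervalIntegral.integral_add (hf2.const_mul _) (hf1.const_mul _)]
  rw [← Real.norm_eq_abs]
  refine intervalIntegral.norm_integral_le_of_norm_le ht (Eventually.of_forall fun τ hτ => ?_)
    ((hf2.const_mul _).add (hf1.const_mul _))
  have hτ' := Ioc_subset_Icc_self hτ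
  obtain ⟨i0, l0⟩ := hfi τ hτ' 0 (by norm_num)
  obtain ⟨i1, l1⟩ := hfi τ hτ' 1 (by norm_num)
  have h0 := sq_le_sqnorm hf i0 i1 l0 one_pos le_rfl
  have h1 := sq_le_sqnorm (contDiff_pdx hf) i1 (hfi τ hτ' 2 le_rfl).1 l1 hl le_rfl
  have hprod : |f 0 τ * pdx f 0 τ| ≤ (f 0 τ ^ 2 + pdx f 0 τ ^ 2) / 2 :=
    abs_le.2 ⟨by nlinarith [sq_nonneg (f 0 τ + pdx f 0 τ)],
      by nlinarith [sq_nonneg (f 0 τ - pdx f 0 τ)]⟩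
  have hn := sqnorm_nonneg f τ
  have hη' : P / 2 * (P / (2 * η))⁻¹ = η := by field_simp
  rw [Real.norm_eq_abs, mul_assoc, abs_mul, Hsq_one]
  calc |q τ| * |f 0 τ * pdx f 0 τ|
      ≤ P * ((f 0 τ ^ 2 + pdx f 0 τ ^ 2) / 2) :=
        mul_le_mul (hq τ) hprod (abs_nonneg _) hP.le
    _ ≤ P / 2 * ((sqnorm f τ + sqnorm (pdx f) τ) + (P / (2 * η) * (sqnorm f τ + sqnorm (pdx f) τ)
          + (P / (2 * η))⁻¹ * sqnorm (pdx (pdx f)) τ)) := by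
        have := mul_nonneg hl.le hn
        rw [one_mul, inv_one, one_mul] at h0
        nlinarith
    _ = P / 2 * (P / (2 * η))⁻¹ * sqnorm (pdx (pdx f)) τ
          + P / 2 * (1 + P / (2 * η)) * (sqnorm f τ + sqnorm (pdx f) τ) := by ring
    _ = _ := by rw [hη']; rfl

lemma abs_integral_deriv_mul_wave_le {Y Y' W W' : ℝ → ℝ} {D s c b t : ℝ} (hs : 0 < s) (hc : 0 < c)
    (hb : b ≤ 0) (ht : 0 ≤ t) (hY : ∀ τ, HasDerivAt Y (Y' τ) τ) (hY' : Continuous Y')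
    (hW : ∀ ξ, HasDerivAt W (W' ξ) ξ) (hW' : Continuous W')
    (hY1 : ∀ τ ∈ Icc 0 t, |Y τ| ≤ 1) (hWd : ∀ ξ, |W ξ| ≤ D * exp (-(c * |ξ|)))
    (hWd' : ∀ ξ, |W' ξ| ≤ D * exp (-(c * |ξ|))) :
    |∫ τ in (0 : ℝ)..t, Y' τ * W (-(s * τ) + b)| ≤ D * (2 + 1 / c) * exp (c * b) := by
  have hD : 0 ≤ D := by simpa using (abs_nonneg _).trans (hWd 0)
  have hZ : ∀ τ, HasDerivAt (fun τ => W (-(s * τ) + b)) (W' (-(s * τ) + b) * -s) τ := fun τ =>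
    (hW _).comp τ ((((hasDerivAt_id τ).const_mul s).neg.add_const b).congr_deriv (by simp))
  have hexp : ∀ τ ≥ 0, exp (-(c * |-(s * τ) + b|)) = exp (c * b) * exp (-(c * s) * τ) := by
    intro τ hτ
    rw [abs_of_nonpos (by nlinarith [mul_nonneg hs.le hτ]), ← exp_add]
    congr 1
    ring
  have hle : ∀ τ ≥ 0, exp (-(c * s) * τ) ≤ 1 := fun τ hτ =>
    exp_le_one_iff.2 (by nlinarith [mul_nonneg (mul_nonneg hc.le hs.le) hτ])
  have hend : ∀ τ ∈ Icc 0 t, |Y τ * W (-(s * τ) + b)| ≤ D * exp (c * b) := by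
    intro τ hτ
    have h1 := hWd (-(s * τ) + b)
    rw [hexp τ hτ.1] at h1
    rw [abs_mul]
    calc |Y τ| * |W (-(s * τ) + b)| ≤ 1 * (D * (exp (c * b) * 1)) :=
          mul_le_mul (hY1 τ hτ) (h1.trans (by gcongr; exact hle τ hτ.1)) (abs_nonneg _) one_pos.le
      _ = _ := by ring
  have hibp := intervalIntegral.integral_deriv_mul_eq_sub (a := 0) (b := t)
    (fun τ _ => hY τ) (fun τ _ => hZ τ) (hY'.intervalIntegrable _ _)
    ((by fun_prop : Continuous fun τ => W' (-(s * τ) + b) * -s).intervalIntegrable _ _)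
  have hYc : Continuous Y := continuous_iff_continuousAt.2 fun τ => (hY τ).continuousAt
  have hWc : Continuous W := continuous_iff_continuousAt.2 fun τ => (hW τ).continuousAt
  have i1 : IntervalIntegrable (fun τ => Y' τ * W (-(s * τ) + b)) volume 0 t :=
    (by fun_prop : Continuous fun τ => Y' τ * W (-(s * τ) + b)).intervalIntegrable _ _
  have i2 : IntervalIntegrable (fun τ => Y τ * (W' (-(s * τ) + b) * -s)) volume 0 t :=
    (by fun_prop : Continuous fun τ => Y τ * (W' (-(s * τ) + b) * -s)).intervalIntegrable _ _
  rw [intervalIntegral.integral_add i1 i2] at hibp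
  have hcs : 0 < c * s := mul_pos hc hs
  have hJ : |∫ τ in (0 : ℝ)..t, Y τ * (W' (-(s * τ) + b) * -s)| ≤ D * exp (c * b) * (1 / c) := by
    have h1 : |∫ τ in (0 : ℝ)..t, Y τ * (W' (-(s * τ) + b) * -s)|
        ≤ ∫ τ in (0 : ℝ)..t, D * exp (c * b) * s * exp (-(c * s) * τ) := by
      have hbound : IntervalIntegrable (fun τ => D * exp (c * b) * s * exp (-(c * s) * τ))
          volume 0 t := Continuous.intervalIntegrable (by fun_prop) _ _
      rw [← Real.norm_eq_abs]
      refine intervalIntegral.norm_integral_le_of_norm_le ht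
        (Eventually.of_forall fun τ hτ => ?_) hbound
      have h2 := hWd' (-(s * τ) + b)
      rw [hexp τ hτ.1.le] at h2
      rw [Real.norm_eq_abs, abs_mul, abs_mul, abs_neg, abs_of_pos hs]
      calc |Y τ| * (|W' (-(s * τ) + b)| * s)
          ≤ 1 * (D * (exp (c * b) * exp (-(c * s) * τ)) * s) :=
            mul_le_mul (hY1 τ (Ioc_subset_Icc_self hτ)) (by gcongr) (by positivity) one_pos.le
        _ = _ := by ring
    refine h1.trans ?_
    have hprim : ∀ τ ∈ uIcc 0 t, HasDerivAt (fun τ => -(exp (-(c * s) * τ) / (c * s)))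
        (exp (-(c * s) * τ)) τ := fun τ _ =>
      (((((hasDerivAt_id τ).const_mul (-(c * s))).exp).div_const (c * s)).neg).congr_deriv
        (by field_simp; simp)
    rw [intervalIntegral.integral_const_mul, intervalIntegral.integral_eq_sub_of_hasDerivAt hprim
      ((by fun_prop : Continuous fun τ => exp (-(c * s) * τ)).intervalIntegrable _ _)]
    have h3 : -(exp (-(c * s) * t) / (c * s)) - -(exp (-(c * s) * 0) / (c * s)) ≤ 1 / (c * s) := by
      rw [mul_zero, exp_zero]
      have : 0 ≤ exp (-(c * s) * t) / (c * s) := by positivity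
      linarith
    calc _ ≤ D * exp (c * b) * s * (1 / (c * s)) := by gcongr
      _ = _ := by field_simp
  have h0 := abs_le.1 (hend 0 ⟨le_rfl, ht⟩)
  have h1 := abs_le.1 (hend t ⟨ht, le_rfl⟩)
  have h2 := abs_le.1 hJ
  have hring : D * (2 + 1 / c) * exp (c * b)
      = D * exp (c * b) + D * exp (c * b) + D * exp (c * b) * (1 / c) := by ring
  rw [hring]
  exact abs_le.2 ⟨by linarith, by linarith⟩

lemma intervalIntegrable_sqnorm_of_le {f : ℝ → ℝ → ℝ} {T B : ℝ} (hT : 0 ≤ T)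
    (hf : Continuous (Function.uncurry f))
    (hfi : ∀ τ ∈ Icc 0 T, IntegrableOn (fun x => (f x τ) ^ 2) (Ioi 0))
    (hB : ∀ τ ∈ Icc 0 T, sqnorm f τ ≤ B) : IntervalIntegrable (sqnorm f) volume 0 T := by
  have hf2 : Continuous (Function.uncurry fun x t => f x t ^ 2) := hf.pow 2
  refine intervalIntegrable_integral_Ioi_of_bounded (B := T * B) hT hf2
    (fun _ _ => sq_nonneg _) fun R hR => ?_
  have hR0 : 0 ≤ R := zero_le_one.trans hR
  have h := intervalIntegral.integral_mono_on hT
    (intervalIntegrable_integral_rect hR0 hT hf2.continuousOn)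
    (intervalIntegrable_const (c := B)) fun τ hτ => ?_
  · simpa using h
  · refine le_trans ?_ (hB τ hτ)
    rw [intervalIntegral.integral_of_le hR0]
    exact setIntegral_mono_set (hfi τ hτ) (ae_of_all _ fun _ => sq_nonneg _)
      Ioc_subset_Ioi_self.eventuallyLE

end BoundaryTerms

section ShockProfile

lemma mem_Icc_of_exp_decay {V : ℝ → ℝ} {vm vp c K : ℝ} (hc : 0 < c) (hV : Monotone V)
    (hm : ∀ ξ ≤ 0, |V ξ - vm| ≤ K * exp (c * ξ))
    (hp : ∀ ξ ≥ 0, |V ξ - vp| ≤ K * exp (-(c * ξ))) (ξ : ℝ) : V ξ ∈ Icc vm vp := by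
  have hbot : Tendsto V atBot (nhds vm) := by
    rw [tendsto_iff_norm_sub_tendsto_zero]
    have h1 : Tendsto (fun ξ => K * exp (c * ξ)) atBot (nhds 0) := by
      simpa using (tendsto_exp_atBot.comp (tendsto_id.const_mul_atBot hc)).const_mul K
    exact squeeze_zero' (Eventually.of_forall fun _ => norm_nonneg _)
      ((eventually_le_atBot 0).mono hm) h1
  have htop : Tendsto V atTop (nhds vp) := by
    rw [tendsto_iff_norm_sub_tendsto_zero]
    have h1 : Tendsto (fun ξ => K * exp (-(c * ξ))) atTop (nhds 0) := by
      simpa using (tendsto_exp_atBot.comp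
        (tendsto_neg_atTop_atBot.comp (tendsto_id.const_mul_atTop hc))).const_mul K
    exact squeeze_zero' (Eventually.of_forall fun _ => norm_nonneg _)
      ((eventually_ge_atTop 0).mono hp) h1
  exact ⟨hV.le_of_tendsto hbot ξ, hV.ge_of_tendsto htop ξ⟩

lemma pdx_trace_eq_pdt {f g : ℝ → ℝ → ℝ} {T : ℝ} (hT : 0 < T)
    (hf : ContDiff ℝ (⊤ : ℕ∞) (Function.uncurry f)) (hg : ContDiff ℝ (⊤ : ℕ∞) (Function.uncurry g))
    (h : ∀ x ∈ Ioi (0 : ℝ), ∀ t ∈ Ioo (0 : ℝ) T, pdt f x t = g x t) :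
    (∀ x ∈ Ioi (0 : ℝ), ∀ t ∈ Ioo (0 : ℝ) T, pdt (pdx f) x t = pdx g x t) ∧
      ∀ t ∈ Icc (0 : ℝ) T, pdx g 0 t = pdt (pdx f) 0 t := by
  have h1 : ∀ x ∈ Ioi (0 : ℝ), ∀ t ∈ Ioo (0 : ℝ) T, pdt (pdx f) x t = pdx g x t := by
    intro x hx t ht
    rw [pdt_pdx_comm hf]
    exact pdx_congr_of_pos (fun y hy => h y hy t ht) hx
  exact ⟨h1, fun t ht => (eq_on_closed_strip (contDiff_pdt (contDiff_pdx hf)).continuous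
    (contDiff_pdx hg).continuous hT h1 le_rfl ht).symm⟩

end ShockProfile

/-- Boundary estimates (fourth group): (i) the `p'(V)φ_xx φ_xxx` boundary term with an `η`-Young splitting, (ii) the `ψ_xx ψ_xxx` boundary term. -/
theorem boundary_estimates_fourth
    (p : ℝ → ℝ) (μ κ s c₁ C₁ vm vp : ℝ)
    (hp : ContDiffOn ℝ (⊤ : ℕ∞) p (Set.Ioi 0))
    (hp1 : ∀ v > (0:ℝ), deriv p v < 0)
    (hp2 : ∀ v > (0:ℝ), deriv (deriv p) v > 0)
    (hμ : 0 < μ) (hκ : 0 < κ) (hs : 0 < s) (hc₁ : 0 < c₁) (hC₁ : 0 < C₁)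
    (hvm : 0 < vm) (hvmvp : vm < vp) :
    ∃ δ₀ > 0, ∃ ε₀ > 0, ∃ C > 0, ∀ η > 0, ∃ Cη > 0,
      ∀ (up α β T ε : ℝ) (V U : ℝ → ℝ) (φ ψ : ℝ → ℝ → ℝ),
        up < 0 → |α| < 1 → 1 < β → 0 < T → 0 < ε → ε < 1 →
        ContDiff ℝ (⊤ : ℕ∞) V → ContDiff ℝ (⊤ : ℕ∞) U →
        (∀ ξ : ℝ, s * V ξ + U ξ = s * vm) →
        (∀ ξ : ℝ, μ * deriv U ξ / V ξ - κ * deriv (deriv V) ξ / (V ξ) ^ 5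
            + (5 * κ / 2) * (deriv V ξ) ^ 2 / (V ξ) ^ 6
          = -(s * U ξ) + p (V ξ) - p vm) →
        (∀ ξ : ℝ, 0 < deriv V ξ) → (∀ ξ : ℝ, deriv U ξ < 0) →
        (∀ ξ ≤ (0:ℝ), |V ξ - vm| + |U ξ| ≤ C₁ * (vp - vm) * Real.exp (c₁ * ξ)) →
        (∀ ξ ≥ (0:ℝ), |V ξ - vp| + |U ξ - up| ≤ C₁ * (vp - vm) * Real.exp (-(c₁ * ξ))) →
        (∀ ξ : ℝ, |deriv V ξ| + |deriv U ξ|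
          ≤ C₁ * (vp - vm) ^ 2 * Real.exp (-(c₁ * |ξ|))) →
        (∀ ξ : ℝ, |deriv (deriv V) ξ| + |deriv (deriv U) ξ|
          ≤ C₁ * (vp - vm) ^ 2 * Real.exp (-(c₁ * |ξ|))) →
        (∀ ξ : ℝ, |deriv (deriv (deriv V)) ξ| + |deriv (deriv (deriv U)) ξ|
          ≤ C₁ * (vp - vm) ^ 2 * Real.exp (-(c₁ * |ξ|))) →
        ContDiff ℝ (⊤ : ℕ∞) (Function.uncurry φ) →
        ContDiff ℝ (⊤ : ℕ∞) (Function.uncurry ψ) →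
        (∀ t ∈ Set.Icc (0:ℝ) T, ∀ j ≤ 4,
          IntegrableOn (fun x => (pdx^[j] φ x t) ^ 2) (Set.Ioi 0) ∧
          Tendsto (fun x => pdx^[j] φ x t) atTop (nhds 0)) →
        (∀ t ∈ Set.Icc (0:ℝ) T, ∀ j ≤ 3,
          IntegrableOn (fun x => (pdx^[j] ψ x t) ^ 2) (Set.Ioi 0) ∧
          Tendsto (fun x => pdx^[j] ψ x t) atTop (nhds 0)) →
        (∀ x ≥ (0:ℝ), ∀ t ∈ Set.Icc (0:ℝ) T,
          vm / 2 ≤ V (x - s * t + α - β) + pdx φ x t ∧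
          V (x - s * t + α - β) + pdx φ x t ≤ 3 / 2 * vp) →
        (∀ x ∈ Set.Ioi (0:ℝ), ∀ t ∈ Set.Ioo (0:ℝ) T, pdt φ x t - pdx ψ x t = 0) →
        (∀ x ∈ Set.Ioi (0:ℝ), ∀ t ∈ Set.Ioo (0:ℝ) T,
          pdt ψ x t + deriv p (V (x - s * t + α - β)) * pdx φ x t
            - μ / V (x - s * t + α - β) * pdx (pdx ψ) x t
            + κ * pdx (pdx (pdx φ)) x t / (V (x - s * t + α - β) + pdx φ x t) ^ 5
            + μ * deriv U (x - s * t + α - β) * pdx φ x t / (V (x - s * t + α - β)) ^ 2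
          = NSKF p μ κ s α β V U φ ψ x t) →
        (∀ t ∈ Set.Icc (0:ℝ) T, φ 0 t = ∫ τ in Set.Ici t, U (-(s * τ) + α - β)) →
        (∀ t ∈ Set.Icc (0:ℝ) T, pdx ψ 0 t = -U (-(s * t) + α - β)) →
        (∀ t ∈ Set.Icc (0:ℝ) T,
          pdx (pdx φ) 0 t = (s ^ 2)⁻¹ * (s * deriv U (-(s * t) + α - β))) →
        (∀ t ∈ Set.Icc (0:ℝ) T, Real.sqrt (Hsq 3 φ t) + Real.sqrt (Hsq 2 ψ t) ≤ ε) →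
        vp - vm ≤ δ₀ → ε ≤ ε₀ →
        ∀ t ∈ Set.Icc (0:ℝ) T,
          (|∫ τ in (0:ℝ)..t,
              deriv p (V (-(s * τ) + α - β)) * pdx (pdx φ) 0 τ * pdx (pdx (pdx φ)) 0 τ|
            ≤ η * (∫ τ in (0:ℝ)..t, sqnorm (pdx^[4] φ) τ)
              + Cη * (∫ τ in (0:ℝ)..t, Hsq 1 (pdx (pdx φ)) τ)) ∧
          (|∫ τ in (0:ℝ)..t, pdx (pdx ψ) 0 τ * pdx (pdx (pdx ψ)) 0 τ|
            ≤ C * (∫ τ in (0:ℝ)..t, Hsq 1 (pdx (pdx ψ)) τ) + C * Real.exp (-(c₁ * β))) := by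
  have hvp : 0 < vp - vm := sub_pos.2 hvmvp
  obtain ⟨P, hP0, hP⟩ := exists_bound_deriv hp hvm vp
  set D := C₁ * (vp - vm) ^ 2 with hD
  have hD0 : 0 < D := by positivity
  refine ⟨1, one_pos, 1, one_pos, D * (2 + 1 / c₁) * exp c₁, by positivity, fun η hη =>
    ⟨P / 2 * (1 + P / (2 * η)), by positivity, ?_⟩⟩
  intro up α β T ε V U φ ψ _ hα hβ hT _ hε1 hV hU hmassV hprof hV' hU' hVm hVp hd1 hd2 hd3
    hφ hψ hφi hψi hbd hmass hmom _ _ hφ2bd hN _ _ t ht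
  have hVmem : ∀ ξ, V ξ ∈ Icc vm vp := mem_Icc_of_exp_decay (K := C₁ * (vp - vm)) hc₁
    (strictMono_of_deriv_pos hV').monotone
    (fun ξ hξ => (le_add_of_nonneg_right (abs_nonneg _)).trans (hVm ξ hξ))
    (fun ξ hξ => (le_add_of_nonneg_right (abs_nonneg _)).trans (hVp ξ hξ))
  have hVU : ∀ ξ, s * deriv V ξ + deriv U ξ = 0 := by
    intro ξ
    have h1 := (((hV.differentiable (by simp) ξ).hasDerivAt.const_mul s).fun_add
      (hU.differentiable (by simp) ξ).hasDerivAt).deriv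
    rw [← h1, funext hmassV, deriv_const]
  have hφ1 := contDiff_pdx hφ
  have hφ2 := contDiff_pdx hφ1
  have hψ1 := contDiff_pdx hψ
  have hHφ : ∀ τ ∈ Icc 0 T, Hsq 3 φ τ ≤ 1 := fun τ hτ => by
    have h1 := hN τ hτ
    have h2 := Real.sqrt_nonneg (Hsq 2 ψ τ)
    simpa using (Real.sqrt_le_left one_pos.le).1 (show √(Hsq 3 φ τ) ≤ 1 by linarith)
  have hHψ : ∀ τ ∈ Icc 0 T, Hsq 2 ψ τ ≤ 1 := fun τ hτ => by
    have h1 := hN τ hτ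
    have h2 := Real.sqrt_nonneg (Hsq 3 φ τ)
    simpa using (Real.sqrt_le_left one_pos.le).1 (show √(Hsq 2 ψ τ) ≤ 1 by linarith)
  have hφn : ∀ τ ∈ Icc 0 T, ∀ j ≤ 3, sqnorm (pdx^[j] φ) τ ≤ 1 := fun τ hτ j hj =>
    (sqnorm_le_Hsq hj).trans (hHφ τ hτ)
  have hψn : ∀ τ ∈ Icc 0 T, ∀ j ≤ 2, sqnorm (pdx^[j] ψ) τ ≤ 1 := fun τ hτ j hj =>
    (sqnorm_le_Hsq hj).trans (hHψ τ hτ)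
  have hsub : Icc 0 t ⊆ Icc 0 T := Icc_subset_Icc_right ht.2
  have hsub' : uIcc 0 t ⊆ uIcc 0 T := by rwa [uIcc_of_le ht.1, uIcc_of_le hT.le]
  constructor
  · have hf4 := (intervalIntegrable_sqnorm_fourth hp hμ hκ hs hc₁ hvm hT hV hU hVU hprof
      (fun ξ => (hVmem ξ).1) (fun ξ => (le_add_of_nonneg_right (abs_nonneg _)).trans (hd1 ξ))
      (fun ξ => (le_add_of_nonneg_right (abs_nonneg _)).trans (hd2 ξ))
      (fun ξ => (le_add_of_nonneg_right (abs_nonneg _)).trans (hd3 ξ))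
      (fun ξ => (le_add_of_nonneg_left (abs_nonneg _)).trans (hd1 ξ))
      hφ hψ hφi hψi hbd hmass hmom hφn hψn).mono_set hsub'
    have hf2 : IntervalIntegrable (sqnorm (pdx (pdx φ))) volume 0 t :=
      intervalIntegrable_sqnorm_of_le ht.1 hφ2.continuous
        (fun τ hτ => (hφi τ (hsub hτ) 2 (by norm_num)).1)
        (fun τ hτ => hφn τ (hsub hτ) 2 (by norm_num))
    have hf3 : IntervalIntegrable (sqnorm (pdx (pdx (pdx φ)))) volume 0 t :=
      intervalIntegrable_sqnorm_of_le ht.1 (contDiff_pdx hφ2).continuous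
        (fun τ hτ => (hφi τ (hsub hτ) 3 (by norm_num)).1)
        (fun τ hτ => hφn τ (hsub hτ) 3 (by norm_num))
    have hf1 : IntervalIntegrable (Hsq 1 (pdx (pdx φ))) volume 0 t := by
      rw [funext (Hsq_one (pdx (pdx φ)))]
      exact hf2.add hf3
    exact abs_integral_mul_trace_le (f := pdx (pdx φ)) hP0 hη ht.1 hφ2
      (fun τ hτ j hj => hφi τ (hsub hτ) (j + 2) (by lia)) (fun τ => hP _ (hVmem _)) hf4 hf1
  · obtain ⟨hx1, htr1⟩ := pdx_trace_eq_pdt hT hφ hψ1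
      (fun x hx τ hτ => sub_eq_zero.1 (hmass x hx τ hτ))
    have htr2 := (pdx_trace_eq_pdt hT hφ1 (contDiff_pdx hψ1) hx1).2
    have hU1s := contDiff_deriv hU
    have hU2s := contDiff_deriv hU1s
    have hU3s := contDiff_deriv hU2s
    have hder : ∀ τ ∈ Ioo 0 T,
        pdt (pdx (pdx φ)) 0 τ = -deriv (deriv U) (-(s * τ) + (α - β)) := by
      intro τ hτ
      have h1 : HasDerivAt (fun r => (s ^ 2)⁻¹ * (s * deriv U (-(s * r) + α - β)))
          ((s ^ 2)⁻¹ * (s * (deriv (deriv U) (-(s * τ) + α - β) * -s))) τ := by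
        have h2 : HasDerivAt (fun r => -(s * r) + α - β) (-s) τ :=
          ((((hasDerivAt_id τ).const_mul s).neg.add_const α).sub_const β).congr_deriv (by simp)
        have h3 : HasDerivAt (deriv U) (deriv (deriv U) (-(s * τ) + α - β)) (-(s * τ) + α - β) :=
          (hU1s.differentiable (by simp) _).hasDerivAt
        exact ((h3.comp τ h2).const_mul s).const_mul _
      have h4 : pdt (pdx (pdx φ)) 0 τ = _ := (h1.congr_of_eventuallyEq
        (f₁ := fun r => pdx (pdx φ) 0 r)
        (eventually_of_mem (Icc_mem_nhds hτ.1 hτ.2) hφ2bd)).deriv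
      rw [h4, add_sub_assoc]
      field_simp
    have hφx : ∀ τ ∈ Icc 0 t, |pdx φ 0 τ| ≤ 1 := by
      intro τ hτ
      have h1 := sq_le_sqnorm hφ1 (hφi τ (hsub hτ) 1 (by norm_num)).1
        (hφi τ (hsub hτ) 2 (by norm_num)).1 (hφi τ (hsub hτ) 1 (by norm_num)).2 one_pos le_rfl
      have h2 : sqnorm (pdx φ) τ + sqnorm (pdx (pdx φ)) τ ≤ Hsq 3 φ τ := by
        have e : Hsq 3 φ τ = sqnorm φ τ + sqnorm (pdx φ) τ + sqnorm (pdx (pdx φ)) τ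
            + sqnorm (pdx (pdx (pdx φ))) τ := by
          simp [Hsq, Finset.sum_range_succ]
        linarith [sqnorm_nonneg φ τ, sqnorm_nonneg (pdx (pdx (pdx φ))) τ]
      rw [inv_one, one_mul, one_mul] at h1
      exact abs_le_one_iff_mul_self_le_one.2 (by nlinarith [hHφ τ (hsub hτ)])
    have hcongr : ∫ τ in (0 : ℝ)..t, pdx (pdx ψ) 0 τ * pdx (pdx (pdx ψ)) 0 τ
        = ∫ τ in (0 : ℝ)..t, pdt (pdx φ) 0 τ * -deriv (deriv U) (-(s * τ) + (α - β)) := by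
      refine intervalIntegral.integral_congr_Ioo_of_le ht.1 fun τ hτ => ?_
      have hτ' : τ ∈ Ioo 0 T := ⟨hτ.1, hτ.2.trans_le ht.2⟩
      simp only [htr1 τ (Ioo_subset_Icc_self hτ'), htr2 τ (Ioo_subset_Icc_self hτ'), hder τ hτ']
    have hmain := abs_integral_deriv_mul_wave_le (Y := fun τ => pdx φ 0 τ)
      (W := fun ξ => -deriv (deriv U) ξ) (W' := fun ξ => -deriv (deriv (deriv U)) ξ) (D := D)
      (b := α - β) hs hc₁ (by linarith [(abs_lt.1 hα).2]) ht.1 (hasDerivAt_pdt hφ1 0)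
      (continuous_slice_snd (contDiff_pdt hφ1) 0)
      (fun ξ => (hU2s.differentiable (by simp) ξ).hasDerivAt.neg) hU3s.continuous.neg hφx
      (fun ξ => by
        rw [abs_neg]; exact (le_add_of_nonneg_left (abs_nonneg _)).trans (hd2 ξ))
      (fun ξ => by
        rw [abs_neg]; exact (le_add_of_nonneg_left (abs_nonneg _)).trans (hd3 ξ))
    have hexp : exp (c₁ * (α - β)) ≤ exp c₁ * exp (-(c₁ * β)) := by
      rw [← exp_add]
      exact exp_le_exp.2 (by nlinarith [(abs_lt.1 hα).2])
    have hHnn : 0 ≤ ∫ τ in (0 : ℝ)..t, Hsq 1 (pdx (pdx ψ)) τ :=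
      intervalIntegral.integral_nonneg ht.1 fun τ _ => Hsq_nonneg _ _ _
    rw [hcongr]
    calc _ ≤ D * (2 + 1 / c₁) * exp (c₁ * (α - β)) := hmain
      _ ≤ D * (2 + 1 / c₁) * (exp c₁ * exp (-(c₁ * β))) := by gcongr
      _ = D * (2 + 1 / c₁) * exp c₁ * exp (-(c₁ * β)) := by ring
      _ ≤ _ := le_add_of_nonneg_left (by positivity)
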